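/- arXiv:1404.0907 — 4 statements merged into one kernel-verified Lean document; each statement's English description precedes it below -/
import Mathlib

section
/- Let (H,δ) be a chain of Hilbert spaces H_p and bounded operators δ_p ∈ L(H_p,H_{p−1}), p ∈ ℤ, with H_p = 0 and δ_p = 0 for p < 0 and p ≥ n+1, and such that R(δ_pδ_{p+1}) is finite-dimensional for each p ∈ ℤ. Then (H,δ) is a Fredholm chain if and only if δ_{p+1}δ_{p+1}* + δ_p*δ_p ∈ L(H_p) is a Fredholm (self-adjoint) operator for each p ∈ ℤ. -/
open Module ContinuousLinearMap

noncomputable section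

set_option maxHeartbeats 1000000
set_option synthInstance.maxHeartbeats 1000000

/-- For submodules `p q` of a space `E`, the quotient space `p / (p ⊓ q)`. -/
abbrev relQuot {E : Type*} [AddCommGroup E] [Module ℂ E] (p q : Submodule ℂ E) : Type _ :=
  ↥p ⧸ ((p ⊓ q).comap p.subtype)

section Defs

variable {H₁ H₂ : Type*} [NormedAddCommGroup H₁] [NormedSpace ℂ H₁]
  [NormedAddCommGroup H₂] [NormedSpace ℂ H₂]

/-- `(S, T)` is a Fredholm pair if the four quotients `N(S)/(N(S) ⊓ R(T))`,
`R(T)/(N(S) ⊓ R(T))`, `N(T)/(N(T) ⊓ R(S))`, `R(S)/(N(T) ⊓ R(S))` are finite dimensional. -/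
def IsFredholmPair (S : H₁ →L[ℂ] H₂) (T : H₂ →L[ℂ] H₁) : Prop :=
  FiniteDimensional ℂ (relQuot (LinearMap.ker S.toLinearMap) (LinearMap.range T.toLinearMap)) ∧
  FiniteDimensional ℂ (relQuot (LinearMap.range T.toLinearMap) (LinearMap.ker S.toLinearMap)) ∧
  FiniteDimensional ℂ (relQuot (LinearMap.ker T.toLinearMap) (LinearMap.range S.toLinearMap)) ∧
  FiniteDimensional ℂ (relQuot (LinearMap.range S.toLinearMap) (LinearMap.ker T.toLinearMap))

/-- The index of a Fredholm pair:
`ind (S,T) = dim N(S)/(N(S)⊓R(T)) - dim R(T)/(N(S)⊓R(T)) - dim N(T)/(N(T)⊓R(S)) + dim R(S)/(N(T)⊓R(S))`. -/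
def pairIndex (S : H₁ →L[ℂ] H₂) (T : H₂ →L[ℂ] H₁) : ℤ :=
  (finrank ℂ (relQuot (LinearMap.ker S.toLinearMap) (LinearMap.range T.toLinearMap)) : ℤ)
    - (finrank ℂ (relQuot (LinearMap.range T.toLinearMap) (LinearMap.ker S.toLinearMap)) : ℤ)
    - (finrank ℂ (relQuot (LinearMap.ker T.toLinearMap) (LinearMap.range S.toLinearMap)) : ℤ)
    + (finrank ℂ (relQuot (LinearMap.range S.toLinearMap) (LinearMap.ker T.toLinearMap)) : ℤ)

/-- A bounded operator is Fredholm if its kernel is finite dimensional, its range is closed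
and its cokernel is finite dimensional. -/
def IsFredholmOp (A : H₁ →L[ℂ] H₂) : Prop :=
  FiniteDimensional ℂ (LinearMap.ker A.toLinearMap) ∧ IsClosed (LinearMap.range A.toLinearMap : Set H₂) ∧
  FiniteDimensional ℂ (H₂ ⧸ LinearMap.range A.toLinearMap)

/-- The index of a Fredholm operator: `ind A = dim N(A) - dim H₂/R(A)`. -/
def opIndex (A : H₁ →L[ℂ] H₂) : ℤ :=
  (finrank ℂ (LinearMap.ker A.toLinearMap) : ℤ) - (finrank ℂ (H₂ ⧸ LinearMap.range A.toLinearMap) : ℤ)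

end Defs

section ChainDefs

variable (H : ℤ → Type*) [∀ p, NormedAddCommGroup (H p)] [∀ p, InnerProductSpace ℂ (H p)]

/-- The identification `H p ≃ H q` coming from an equality of indices `p = q`. -/
def fcast {p q : ℤ} (h : p = q) : H p ≃ₗᵢ[ℂ] H q := by
  subst h; exact LinearIsometryEquiv.refl ℂ (H p)

/-- The identification `H p ≃ H q` as a continuous linear map. -/
def fcastL {p q : ℤ} (h : p = q) : H p →L[ℂ] H q :=
  (fcast H h).toLinearIsometry.toContinuousLinearMap

variable (δ : ∀ p : ℤ, H p →L[ℂ] H (p - 1))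

/-- The range of `δ (p+1)` viewed as a subspace of `H p`. -/
def chainRange (p : ℤ) : Submodule ℂ (H p) :=
  Submodule.map (fcastL H (show p + 1 - 1 = p by ring)).toLinearMap (LinearMap.range (δ (p + 1)).toLinearMap)

/-- The composition `δ p ∘ δ (p+1) : H (p+1) → H (p-1)`. -/
def chainComp (p : ℤ) : H (p + 1) →L[ℂ] H (p - 1) :=
  δ p ∘L (fcastL H (show p + 1 - 1 = p by ring) ∘L δ (p + 1))

/-- `(H, δ)` is a Fredholm chain if `N(δ p)/(N(δ p) ⊓ R(δ (p+1)))` and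
`R(δ (p+1))/(N(δ p) ⊓ R(δ (p+1)))` are finite dimensional for every `p ∈ ℤ`. -/
def IsFredholmChain : Prop :=
  ∀ p : ℤ, FiniteDimensional ℂ (relQuot (LinearMap.ker (δ p).toLinearMap) (chainRange H δ p)) ∧
    FiniteDimensional ℂ (relQuot (chainRange H δ p) (LinearMap.ker (δ p).toLinearMap))

/-- The index of a Fredholm chain supported on `0, …, n`:
`ind (H,δ) = ∑ (-1)^p (dim N(δ p)/(N(δ p) ⊓ R(δ (p+1))) - dim R(δ (p+1))/(N(δ p) ⊓ R(δ (p+1))))`. -/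
def chainIndex (n : ℕ) : ℤ :=
  ∑ j ∈ Finset.range (n + 1), (-1 : ℤ) ^ j *
    ((finrank ℂ (relQuot (LinearMap.ker (δ (j : ℤ)).toLinearMap) (chainRange H δ (j : ℤ))) : ℤ)
      - (finrank ℂ (relQuot (chainRange H δ (j : ℤ)) (LinearMap.ker (δ (j : ℤ)).toLinearMap)) : ℤ))

end ChainDefs

/-- `LeModFinite p q` says that `p` is contained in `q` up to a finite-dimensional subspace. -/
def LeModFinite {E : Type*} [AddCommGroup E] [Module ℂ E] (p q : Submodule ℂ E) : Prop :=
  ∃ F : Submodule ℂ E, F.FG ∧ p ≤ q ⊔ F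

section LeModFinite

variable {E E' : Type*} [AddCommGroup E] [Module ℂ E] [AddCommGroup E'] [Module ℂ E']
  {p q r : Submodule ℂ E}

theorem LeModFinite.of_le (h : p ≤ q) : LeModFinite p q :=
  ⟨⊥, Submodule.fg_bot, by simpa using h⟩

theorem LeModFinite.trans (hpq : LeModFinite p q) (hqr : LeModFinite q r) : LeModFinite p r := by
  obtain ⟨F, hF, hpF⟩ := hpq
  obtain ⟨G, hG, hqG⟩ := hqr
  exact ⟨G ⊔ F, hG.sup hF, hpF.trans <| by rw [← sup_assoc]; exact sup_le_sup_right hqG F⟩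

theorem LeModFinite.sup (hp : LeModFinite p r) (hq : LeModFinite q r) :
    LeModFinite (p ⊔ q) r := by
  obtain ⟨F, hF, hpF⟩ := hp
  obtain ⟨G, hG, hqG⟩ := hq
  exact ⟨F ⊔ G, hF.sup hG, sup_le (hpF.trans (sup_le_sup_left le_sup_left r))
    (hqG.trans (sup_le_sup_left le_sup_right r))⟩

theorem LeModFinite.sup_right (h : LeModFinite p q) (r : Submodule ℂ E) :
    LeModFinite (p ⊔ r) (q ⊔ r) :=
  (h.trans (.of_le le_sup_left)).sup (.of_le le_sup_right)

theorem LeModFinite.map (h : LeModFinite p q) (f : E →ₗ[ℂ] E') :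
    LeModFinite (p.map f) (q.map f) := by
  obtain ⟨F, hF, hpF⟩ := h
  exact ⟨F.map f, hF.map f, by rw [← Submodule.map_sup]; exact Submodule.map_mono hpF⟩

theorem exists_le_inf_sup_of_finiteDimensional_relQuot (h : FiniteDimensional ℂ (relQuot p q)) :
    ∃ F ≤ p, F.FG ∧ p = (p ⊓ q) ⊔ F := by
  obtain ⟨C, hC⟩ := Submodule.exists_isCompl ((p ⊓ q).comap p.subtype)
  refine ⟨C.map p.subtype, Submodule.map_subtype_le p C,
    (Submodule.CoFG.fg_of_isCompl hC h).map _, ?_⟩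
  have := congrArg (Submodule.map p.subtype) hC.sup_eq_top
  rwa [Submodule.map_sup, Submodule.map_comap_subtype, ← inf_assoc, inf_idem,
    Submodule.map_subtype_top, eq_comm] at this

theorem finiteDimensional_relQuot_iff : FiniteDimensional ℂ (relQuot p q) ↔ LeModFinite p q := by
  constructor
  · intro h
    obtain ⟨F, -, hF, hp⟩ := exists_le_inf_sup_of_finiteDimensional_relQuot h
    exact ⟨F, hF, hp.le.trans (sup_le_sup_right inf_le_right F)⟩
  · rintro ⟨F, hF, hpF⟩
    have hker : LinearMap.ker (q.mkQ ∘ₗ p.subtype) = (p ⊓ q).comap p.subtype := by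
      ext x
      simp
    unfold relQuot
    rw [← hker]
    refine Submodule.range_fg_iff_ker_cofg.mp ?_
    refine (hF.map q.mkQ).of_le ?_
    rw [LinearMap.range_comp, Submodule.range_subtype]
    refine (Submodule.map_mono hpF).trans ?_
    simp [Submodule.map_sup]

theorem LeModFinite.inf_left (h : LeModFinite p q) : LeModFinite p (p ⊓ q) := by
  obtain ⟨F, -, hF, hp⟩ :=
    exists_le_inf_sup_of_finiteDimensional_relQuot (finiteDimensional_relQuot_iff.mpr h)
  exact ⟨F, hF, hp.le⟩

theorem leModFinite_top_iff : LeModFinite ⊤ q ↔ q.CoFG := by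
  constructor
  · rintro ⟨F, hF, h⟩
    refine Submodule.FG.cofg_of_codisjoint (codisjoint_iff.mpr ?_) hF
    rw [sup_comm]
    exact top_le_iff.mp h
  · intro h
    obtain ⟨C, hC⟩ := Submodule.exists_isCompl q
    exact ⟨C, h.fg_of_isCompl hC, hC.sup_eq_top.ge⟩

theorem leModFinite_ker_of_map_fg (f : E →ₗ[ℂ] E') (h : (p.map f).FG) :
    LeModFinite p (LinearMap.ker f) := by
  rw [← finiteDimensional_relQuot_iff]
  have hker : LinearMap.ker (f ∘ₗ p.subtype) = (p ⊓ LinearMap.ker f).comap p.subtype := by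
    ext x
    simp
  unfold relQuot
  rw [← hker]
  refine Submodule.range_fg_iff_ker_cofg.mp ?_
  rwa [LinearMap.range_comp, Submodule.range_subtype]

end LeModFinite

section Hilbert

variable {G H K : Type*}
  [NormedAddCommGroup G] [InnerProductSpace ℂ G]
  [NormedAddCommGroup H] [InnerProductSpace ℂ H]
  [NormedAddCommGroup K] [InnerProductSpace ℂ K]

theorem range_comp_subtypeL_ker_orthogonal [CompleteSpace G] (f : G →L[ℂ] H) :
    (f ∘L f.kerᗮ.subtypeL).range = f.range := by
  have h := congrArg (Submodule.map f.toLinearMap)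
    (Submodule.sup_orthogonal_of_hasOrthogonalProjection (K := f.ker))
  rw [Submodule.map_sup, Submodule.map_top, LinearMap.le_ker_iff_map.mp le_rfl, bot_sup_eq] at h
  rw [← h]
  ext y
  simp

theorem ker_comp_subtypeL_ker_orthogonal (f : G →L[ℂ] H) :
    (f ∘L f.kerᗮ.subtypeL).ker = ⊥ := by
  rw [LinearMap.ker_eq_bot']
  rintro ⟨x, hx⟩ h
  exact Subtype.ext ((Submodule.disjoint_def.mp f.ker.orthogonal_disjoint) x h hx)

theorem range_eq_map_of_ker_sup_eq_top (A : G →L[ℂ] H) {q : Submodule ℂ G}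
    (h : A.ker ⊔ q = ⊤) : A.range = q.map A.toLinearMap := by
  rw [LinearMap.range_eq_map, ← h, Submodule.map_sup, LinearMap.le_ker_iff_map.mp le_rfl,
    bot_sup_eq]

theorem leModFinite_range_ker (T : G →L[ℂ] H) (S : H →L[ℂ] K)
    (hST : (S ∘L T).range.FG) : LeModFinite T.range S.ker := by
  refine leModFinite_ker_of_map_fg _ ?_
  rwa [← LinearMap.range_comp]

variable [CompleteSpace G] [CompleteSpace H] [CompleteSpace K]

theorem isClosed_range_of_cofg (f : G →L[ℂ] H) (h : f.range.CoFG) :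
    IsClosed (f.range : Set H) := by
  obtain ⟨C, hC⟩ := Submodule.exists_isCompl f.range
  have : FiniteDimensional ℂ C := .of_fg (h.fg_of_isCompl hC)
  rw [← range_comp_subtypeL_ker_orthogonal] at hC ⊢
  exact closed_complemented_range_of_isCompl_of_ker_eq_bot _ C hC
    C.closed_of_finiteDimensional (ker_comp_subtypeL_ker_orthogonal f)

/-- If the range of a bounded operator agrees with a closed subspace up to finite dimension, then
it is closed. -/
theorem isClosed_range_of_finiteDimensional_relQuot (T : G →L[ℂ] H) {N : Submodule ℂ H}
    (hN : IsClosed (N : Set H)) (h₁ : FiniteDimensional ℂ (relQuot N T.range))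
    (h₂ : FiniteDimensional ℂ (relQuot T.range N)) : IsClosed (T.range : Set H) := by
  have hT : IsClosed ((N.comap T.toLinearMap : Submodule ℂ G) : Set G) := hN.preimage T.continuous
  have := hT.completeSpace_coe
  have := hN.completeSpace_coe
  let f : N.comap T.toLinearMap →L[ℂ] N :=
    (T ∘L (N.comap T.toLinearMap).subtypeL).codRestrict N fun x => x.2
  have hf : f.range = (N ⊓ T.range).comap N.subtype := by
    ext ⟨y, hy⟩
    constructor
    · rintro ⟨x, hx⟩
      exact ⟨hy, x, congrArg Subtype.val hx⟩
    · rintro ⟨-, x, hx⟩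
      have hx' : T x = y := hx
      exact ⟨⟨x, show T x ∈ N by rwa [hx']⟩, Subtype.ext hx'⟩
  have hfc : IsClosed (f.range : Set N) := isClosed_range_of_cofg f (by rw [hf]; exact h₁)
  have hinf : IsClosed ((T.range ⊓ N : Submodule ℂ H) : Set H) := by
    have h := hN.isClosedEmbedding_subtypeVal.isClosedMap _ hfc
    convert h using 1
    rw [hf]
    ext y
    simp [and_comm]
  obtain ⟨F, -, hF, hp⟩ := exists_le_inf_sup_of_finiteDimensional_relQuot h₂
  have : FiniteDimensional ℂ F := .of_fg hF
  rw [hp]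
  exact Submodule.isClosed_sup_finiteDimensional _ F hinf

theorem exists_generalized_inverse (A : G →L[ℂ] H) (hA : IsClosed (A.range : Set H)) :
    ∃ P : H →L[ℂ] G, ∀ g, A (P (A g)) = A g := by
  have := hA.completeSpace_coe
  let f : A.kerᗮ →L[ℂ] A.range :=
    (A ∘L A.kerᗮ.subtypeL).codRestrict A.range fun x => ⟨x, rfl⟩
  have hker : f.ker = ⊥ := by
    rw [← ker_comp_subtypeL_ker_orthogonal A]
    exact ker_codRestrict _ _ _
  have hrange : f.range = ⊤ := by
    rw [eq_top_iff]
    rintro ⟨y, hy⟩ -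
    rw [← range_comp_subtypeL_ker_orthogonal] at hy
    obtain ⟨x, hx⟩ := hy
    exact ⟨x, Subtype.ext hx⟩
  let e := ContinuousLinearEquiv.ofBijective f hker hrange
  refine ⟨A.kerᗮ.subtypeL ∘L e.symm.toContinuousLinearMap ∘L A.range.orthogonalProjectionOnto,
    fun g => ?_⟩
  have h := congrArg Subtype.val
    (ContinuousLinearEquiv.ofBijective_apply_symm_apply f hker hrange ⟨A g, g, rfl⟩)
  have hp : A.range.orthogonalProjectionOnto (A g) = ⟨A g, g, rfl⟩ :=
    Submodule.orthogonalProjectionOnto_mem_subspace_eq_self (⟨A g, g, rfl⟩ : A.range)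
  simp only [coe_comp, Function.comp_apply, hp]
  exact h

theorem ker_sup_range_adjoint (A : G →L[ℂ] H) (hA : IsClosed (A.range : Set H)) :
    A.ker ⊔ (adjoint A).range = ⊤ := by
  obtain ⟨P, hP⟩ := exists_generalized_inverse A hA
  rw [eq_top_iff, ← Submodule.sup_orthogonal_of_hasOrthogonalProjection (K := A.ker)]
  refine sup_le_sup_left (fun x hx => ⟨adjoint P x, ext_inner_right ℂ fun g => ?_⟩) _
  have h : A (g - P (A g)) = 0 := by rw [map_sub, hP, sub_self]
  have h' := (Submodule.mem_orthogonal' _ _).mp hx _ h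
  rw [inner_sub_right, sub_eq_zero] at h'
  rw [h']
  simp [adjoint_inner_left]

theorem range_sup_ker_adjoint (A : G →L[ℂ] H) (hA : IsClosed (A.range : Set H)) :
    A.range ⊔ (adjoint A).ker = ⊤ := by
  have := hA.completeSpace_coe
  rw [← A.orthogonal_range]
  exact Submodule.sup_orthogonal_of_hasOrthogonalProjection

/-- For a self-adjoint operator, finite codimension of the range suffices to be Fredholm. -/
theorem isFredholmOp_iff_of_isSelfAdjoint {A : H →L[ℂ] H} (hA : adjoint A = A) :
    IsFredholmOp A ↔ LeModFinite ⊤ A.range := by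
  rw [leModFinite_top_iff]
  refine ⟨fun h => h.2.2, fun h => ⟨?_, isClosed_range_of_cofg A h, h⟩⟩
  have hker : A.ker = A.rangeᗮ := by rw [A.orthogonal_range, hA]
  refine .of_fg (Submodule.CoFG.fg_of_disjoint (T := A.range) ?_ h)
  rw [hker]
  exact A.range.orthogonal_disjoint.symm

theorem adjoint_laplacian (T : G →L[ℂ] H) (S : H →L[ℂ] K) :
    adjoint (T ∘L adjoint T + adjoint S ∘L S) = T ∘L adjoint T + adjoint S ∘L S := by
  simp [adjoint_comp]

theorem leModFinite_range_laplacian (T : G →L[ℂ] H) (S : H →L[ℂ] K)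
    (hT : IsClosed (T.range : Set H)) (hS : IsClosed (S.range : Set K))
    (h₁ : LeModFinite S.ker T.range) (h₂ : LeModFinite T.range S.ker) :
    LeModFinite ⊤ (T ∘L adjoint T + adjoint S ∘L S).range := by
  set L := T ∘L adjoint T + adjoint S ∘L S with hL
  have htop : LeModFinite ⊤ (S.ker ⊔ (adjoint T).ker) := by
    rw [← range_sup_ker_adjoint T hT]
    exact h₂.sup_right _
  have hTL : LeModFinite T.range L.range := by
    have h := htop.map (T ∘L adjoint T).toLinearMap
    rw [Submodule.map_top] at h
    refine (LeModFinite.of_le ?_).trans (h.trans (.of_le ?_))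
    · rw [range_eq_map_of_ker_sup_eq_top T (ker_sup_range_adjoint T hT)]
      rintro _ ⟨_, ⟨x, rfl⟩, rfl⟩
      exact ⟨x, rfl⟩
    · rw [Submodule.map_sup]
      refine sup_le ?_ ?_
      · rintro _ ⟨x, hx, rfl⟩
        have hx : S x = 0 := hx
        exact ⟨x, by simp [hL, hx]⟩
      · rintro _ ⟨x, hx, rfl⟩
        have hx : adjoint T x = 0 := hx
        simp [hx]
  have hSL : LeModFinite (adjoint S).range L.range := by
    have h := htop.map (adjoint S ∘L S).toLinearMap
    rw [Submodule.map_top] at h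
    refine (LeModFinite.of_le ?_).trans (h.trans (.of_le ?_))
    · rw [range_eq_map_of_ker_sup_eq_top (adjoint S)
        ((sup_comm _ _).trans (range_sup_ker_adjoint S hS))]
      rintro _ ⟨_, ⟨x, rfl⟩, rfl⟩
      exact ⟨x, rfl⟩
    · rw [Submodule.map_sup]
      refine sup_le ?_ ?_
      · rintro _ ⟨x, hx, rfl⟩
        have hx : S x = 0 := hx
        simp [hx]
      · rintro _ ⟨x, hx, rfl⟩
        have hx : adjoint T x = 0 := hx
        exact ⟨x, by simp [hL, hx]⟩
  rw [← ker_sup_range_adjoint S hS]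
  exact (h₁.trans hTL).sup hSL

theorem leModFinite_ker_range (T : G →L[ℂ] H) (S : H →L[ℂ] K) (hST : (S ∘L T).range.FG)
    (hL : LeModFinite ⊤ (T ∘L adjoint T + adjoint S ∘L S).range) :
    LeModFinite S.ker T.range := by
  let F : Submodule ℂ H := (adjoint S).range ⊓ (S ∘L T).range.comap S.toLinearMap
  have hF : F.FG := by
    have : FiniteDimensional ℂ (S ∘L T).range := .of_fg hST
    let g : F →ₗ[ℂ] (S ∘L T).range :=
      (S.toLinearMap ∘ₗ F.subtype).codRestrict _ fun x => x.2.2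
    have hg : Function.Injective g := by
      rw [← LinearMap.ker_eq_bot, LinearMap.ker_eq_bot']
      rintro ⟨x, ⟨y, rfl⟩, hx⟩ h
      have h : S (adjoint S y) = 0 := congrArg Subtype.val h
      refine Subtype.ext ?_
      change adjoint S y = 0
      rw [← inner_self_eq_zero (𝕜 := ℂ), adjoint_inner_left, h, inner_zero_right]
    exact Module.Finite.iff_fg.mp (FiniteDimensional.of_injective g hg)
  refine (LeModFinite.trans (.of_le le_top) hL).inf_left.trans ⟨F, hF, ?_⟩
  rintro _ ⟨hx, x, rfl⟩
  refine Submodule.add_mem_sup ⟨adjoint T x, rfl⟩ ⟨⟨S x, rfl⟩, -adjoint T x, ?_⟩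
  have hx : S (T (adjoint T x) + adjoint S (S x)) = 0 := hx
  rw [map_add] at hx
  simpa using neg_eq_of_add_eq_zero_right hx

end Hilbert

theorem adjoint_fcastL (H : ℤ → Type*) [∀ p, NormedAddCommGroup (H p)]
    [∀ p, InnerProductSpace ℂ (H p)] [∀ p, CompleteSpace (H p)] {p q : ℤ} (h : p = q) :
    adjoint (fcastL H h) = fcastL H h.symm := by
  subst h
  exact adjoint_id

theorem fredholm_chain_iff_selfadjoint (H : ℤ → Type) [∀ p, NormedAddCommGroup (H p)]
    [∀ p, InnerProductSpace ℂ (H p)] [∀ p, CompleteSpace (H p)] (n : ℕ)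
    (hzero : ∀ p : ℤ, (p < 0 ∨ (n : ℤ) + 1 ≤ p) → Subsingleton (H p))
    (δ : ∀ p : ℤ, H p →L[ℂ] H (p - 1))
    (hcomp : ∀ p : ℤ, FiniteDimensional ℂ (LinearMap.range (chainComp H δ p).toLinearMap)) :
    IsFredholmChain H δ ↔
      ∀ p : ℤ, IsFredholmOp
        ((fcastL H (show p + 1 - 1 = p by ring) ∘L
            ((δ (p + 1) ∘L adjoint (δ (p + 1))) ∘L fcastL H (show p = p + 1 - 1 by ring)))
          + (adjoint (δ p) ∘L δ p)) := by
  let T : ∀ p : ℤ, H (p + 1) →L[ℂ] H p := fun p =>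
    fcastL H (show p + 1 - 1 = p by ring) ∘L δ (p + 1)
  have hrange : ∀ p, chainRange H δ p = (T p).range := fun p => (LinearMap.range_comp _ _).symm
  have hlap : ∀ p : ℤ, (fcastL H (show p + 1 - 1 = p by ring) ∘L
      ((δ (p + 1) ∘L adjoint (δ (p + 1))) ∘L fcastL H (show p = p + 1 - 1 by ring)))
        + (adjoint (δ p) ∘L δ p) = T p ∘L adjoint (T p) + adjoint (δ p) ∘L δ p := by
    intro p
    simp only [T, adjoint_comp, adjoint_fcastL]
    rfl
  have hfg : ∀ p, (δ p ∘L T p).range.FG := fun p => Module.Finite.iff_fg.mp (hcomp p)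
  simp only [hlap, isFredholmOp_iff_of_isSelfAdjoint (adjoint_laplacian _ _)]
  constructor
  · intro h p
    have hT : ∀ p, IsClosed ((T p).range : Set (H p)) := fun p =>
      isClosed_range_of_finiteDimensional_relQuot (T p) (δ p).isClosed_ker
        (hrange p ▸ (h p).1) (hrange p ▸ (h p).2)
    have hδ : ∀ p, IsClosed ((δ (p + 1)).range : Set (H (p + 1 - 1))) := by
      intro p
      convert (hT p).preimage (fcast H (show p + 1 - 1 = p by ring)).continuous using 1
      ext y
      exact exists_congr fun x => (fcast H _).injective.eq_iff.symm
    have hp : IsClosed ((δ p).range : Set (H (p - 1))) := by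
      have h' := hδ (p - 1)
      rwa [sub_add_cancel] at h'
    exact leModFinite_range_laplacian (T p) (δ p) (hT p) hp
      (finiteDimensional_relQuot_iff.mp (hrange p ▸ (h p).1))
      (finiteDimensional_relQuot_iff.mp (hrange p ▸ (h p).2))
  · intro h p
    rw [finiteDimensional_relQuot_iff, finiteDimensional_relQuot_iff, hrange p]
    exact ⟨leModFinite_ker_range (T p) (δ p) (hfg p) (h p),
      leModFinite_range_ker (T p) (δ p) (hfg p)⟩
end
end

section
/- Let (H,δ) be a chain of Hilbert spaces H_p and bounded operators δ_p ∈ L(H_p,H_{p−1}), p ∈ ℤ, with H_p = 0 and δ_p = 0 for p < 0 and p ≥ n+1, and such that R(δ_pδ_{p+1}) is finite-dimensional for each p ∈ ℤ. Then the following statements are equivalent: (i) (H,δ) is a Fredholm chain; (ii) ⊕_{p even}(δ_p + δ_{p+1}*), as an operator from ⊕_{p even} H_p to ⊕_{p odd} H_p, is a Fredholm operator; (iii) ⊕_{p odd}(δ_p + δ_{p+1}*), as an operator from ⊕_{p odd} H_p to ⊕_{p even} H_p, is a Fredholm operator. Furthermore, in this case ind(H,δ) = ind ⊕_{p even}(δ_p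 + δ_{p+1}*) = − ind ⊕_{p odd}(δ_p + δ_{p+1}*). -/
open Module ContinuousLinearMap

noncomputable section

set_option maxHeartbeats 1000000
set_option synthInstance.maxHeartbeats 1000000

section AlgebraicIndex

variable {V W X : Type*} [AddCommGroup V] [Module ℂ V] [AddCommGroup W] [Module ℂ W]
  [AddCommGroup X] [Module ℂ X]

/-- The linear map `f` has finite dimensional kernel and cokernel, and index `i`. -/
def HasIndex (f : V →ₗ[ℂ] W) (i : ℤ) : Prop :=
  FiniteDimensional ℂ (LinearMap.ker f) ∧ FiniteDimensional ℂ (W ⧸ LinearMap.range f) ∧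
    (finrank ℂ (LinearMap.ker f) : ℤ) - finrank ℂ (W ⧸ LinearMap.range f) = i

/-- A surjective linear map identifies its codomain with the quotient by its kernel. -/
def quotEquivOfKerEq (f : V →ₗ[ℂ] W) (p : Submodule ℂ V) (hp : LinearMap.ker f = p)
    (hf : Function.Surjective f) : (V ⧸ p) ≃ₗ[ℂ] W :=
  (Submodule.quotEquivOfEq _ _ hp.symm).trans (f.quotKerEquivOfSurjective hf)

theorem finiteDimensional_of_ker_of_range (f : V →ₗ[ℂ] W)
    (h₁ : FiniteDimensional ℂ (LinearMap.ker f)) (h₂ : FiniteDimensional ℂ (LinearMap.range f)) :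
    FiniteDimensional ℂ V := by
  have : FiniteDimensional ℂ (V ⧸ LinearMap.ker f) := f.quotKerEquivRange.symm.finiteDimensional
  exact Module.Finite.of_submodule_quotient (LinearMap.ker f)

theorem HasIndex.of_equiv {P Q : Type*} [AddCommGroup P] [Module ℂ P] [AddCommGroup Q]
    [Module ℂ Q] [FiniteDimensional ℂ P] [FiniteDimensional ℂ Q] (f : V →ₗ[ℂ] W)
    (e₁ : LinearMap.ker f ≃ₗ[ℂ] P) (e₂ : (W ⧸ LinearMap.range f) ≃ₗ[ℂ] Q) :
    HasIndex f (finrank ℂ P - finrank ℂ Q) :=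
  ⟨e₁.symm.finiteDimensional, e₂.symm.finiteDimensional, by
    rw [e₁.finrank_eq, e₂.finrank_eq]⟩

section Comp

variable (f : V →ₗ[ℂ] W) (g : W →ₗ[ℂ] X)

/-- The map `ker (g ∘ f) → ker g` induced by `f`. -/
def kerCompToKer : LinearMap.ker (g ∘ₗ f) →ₗ[ℂ] LinearMap.ker g :=
  f.restrict fun _ hx => hx

/-- The map from the kernel of `g` to the cokernel of `f`. -/
def kerToCoker : LinearMap.ker g →ₗ[ℂ] W ⧸ LinearMap.range f :=
  (LinearMap.range f).mkQ ∘ₗ (LinearMap.ker g).subtype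

/-- The map `coker f → coker (g ∘ f)` induced by `g`. -/
def cokerToCokerComp : (W ⧸ LinearMap.range f) →ₗ[ℂ] X ⧸ LinearMap.range (g ∘ₗ f) :=
  Submodule.mapQ _ _ g (by rintro _ ⟨x, rfl⟩; exact ⟨x, rfl⟩)

/-- The projection `coker (g ∘ f) → coker g`. -/
def cokerCompToCoker : (X ⧸ LinearMap.range (g ∘ₗ f)) →ₗ[ℂ] X ⧸ LinearMap.range g :=
  Submodule.factor
    (show LinearMap.range (g ∘ₗ f) ≤ LinearMap.range g from LinearMap.range_comp_le_range f g)

/-- The kernel of `ker (g ∘ f) → ker g` is the kernel of `f`. -/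
def kerKerCompToKerEquiv : LinearMap.ker (kerCompToKer f g) ≃ₗ[ℂ] LinearMap.ker f :=
  LinearEquiv.ofBijective
    (((LinearMap.ker (g ∘ₗ f)).subtype.domRestrict (LinearMap.ker (kerCompToKer f g))).codRestrict
      (LinearMap.ker f) fun x => congrArg Subtype.val x.2)
    ⟨fun _ _ h => Subtype.ext (Subtype.ext (congrArg (LinearMap.ker f).subtype h :)), fun x =>
      ⟨⟨⟨x, by rw [LinearMap.mem_ker, LinearMap.comp_apply, x.2, map_zero]⟩, Subtype.ext x.2⟩,
        rfl⟩⟩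

theorem ker_kerToCoker : LinearMap.ker (kerToCoker f g) = LinearMap.range (kerCompToKer f g) := by
  ext x
  simp only [kerToCoker, LinearMap.mem_ker, LinearMap.comp_apply, Submodule.subtype_apply,
    Submodule.mkQ_apply, Submodule.Quotient.mk_eq_zero, LinearMap.mem_range]
  constructor
  · rintro ⟨y, hy⟩
    exact ⟨⟨y, by simp [hy]⟩, Subtype.ext hy⟩
  · rintro ⟨y, rfl⟩
    exact ⟨y, rfl⟩

theorem ker_cokerToCokerComp :
    LinearMap.ker (cokerToCokerComp f g) = LinearMap.range (kerToCoker f g) := by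
  ext x
  obtain ⟨w, rfl⟩ := Submodule.mkQ_surjective _ x
  simp only [cokerToCokerComp, kerToCoker, LinearMap.mem_ker, Submodule.mkQ_apply,
    Submodule.mapQ_apply, Submodule.Quotient.mk_eq_zero, LinearMap.mem_range,
    LinearMap.comp_apply, Submodule.subtype_apply]
  constructor
  · rintro ⟨v, hv⟩
    refine ⟨⟨w - f v, by simp [hv]⟩, ?_⟩
    rw [Submodule.Quotient.eq]
    exact ⟨-v, by simp⟩
  · rintro ⟨z, hz⟩
    rw [Submodule.Quotient.eq] at hz
    obtain ⟨v, hv⟩ := hz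
    refine ⟨-v, ?_⟩
    have hz : g z = 0 := z.2
    simp [hv, hz]

theorem ker_cokerCompToCoker :
    LinearMap.ker (cokerCompToCoker f g) = LinearMap.range (cokerToCokerComp f g) := by
  ext x
  obtain ⟨w, rfl⟩ := Submodule.mkQ_surjective _ x
  have hw : cokerCompToCoker f g (Submodule.mkQ _ w) = (LinearMap.range g).mkQ w := rfl
  rw [LinearMap.mem_ker, hw, Submodule.mkQ_apply, Submodule.Quotient.mk_eq_zero]
  constructor
  · rintro ⟨v, rfl⟩
    exact ⟨Submodule.Quotient.mk v, rfl⟩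
  · rintro ⟨z, hz⟩
    obtain ⟨z, rfl⟩ := Submodule.mkQ_surjective _ z
    simp only [cokerToCokerComp, Submodule.mkQ_apply, Submodule.mapQ_apply,
      Submodule.Quotient.eq] at hz
    obtain ⟨v, hv⟩ := hz
    refine ⟨z - f v, ?_⟩
    rw [map_sub, ← LinearMap.comp_apply, hv]
    abel

theorem surjective_cokerCompToCoker : Function.Surjective (cokerCompToCoker f g) :=
  Submodule.factor_surjective (LinearMap.range_comp_le_range f g)

variable {f g} {i j : ℤ}

/-- The alternating sum formula for the kernel-cokernel exact sequence of a composition. -/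
theorem finrank_ker_coker_comp [FiniteDimensional ℂ (LinearMap.ker (g ∘ₗ f))]
    [FiniteDimensional ℂ (LinearMap.ker g)] [FiniteDimensional ℂ (W ⧸ LinearMap.range f)]
    [FiniteDimensional ℂ (X ⧸ LinearMap.range (g ∘ₗ f))] :
    (finrank ℂ (LinearMap.ker (g ∘ₗ f)) : ℤ) - finrank ℂ (X ⧸ LinearMap.range (g ∘ₗ f)) =
      ((finrank ℂ (LinearMap.ker f) : ℤ) - finrank ℂ (W ⧸ LinearMap.range f)) +
      ((finrank ℂ (LinearMap.ker g) : ℤ) - finrank ℂ (X ⧸ LinearMap.range g)) := by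
  have h₁ := (kerCompToKer f g).finrank_range_add_finrank_ker
  have h₂ := (kerToCoker f g).finrank_range_add_finrank_ker
  have h₃ := (cokerToCokerComp f g).finrank_range_add_finrank_ker
  have h₄ := (cokerCompToCoker f g).finrank_range_add_finrank_ker
  rw [(kerKerCompToKerEquiv f g).finrank_eq] at h₁
  rw [ker_kerToCoker] at h₂
  rw [ker_cokerToCokerComp] at h₃
  rw [ker_cokerCompToCoker, LinearMap.range_eq_top.2 (surjective_cokerCompToCoker f g),
    finrank_top] at h₄
  omega

theorem HasIndex.comp (hg : HasIndex g j) (hf : HasIndex f i) : HasIndex (g ∘ₗ f) (i + j) := by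
  obtain ⟨hf₁, hf₂, rfl⟩ := hf
  obtain ⟨hg₁, hg₂, rfl⟩ := hg
  have h₁ : FiniteDimensional ℂ (LinearMap.ker (g ∘ₗ f)) :=
    finiteDimensional_of_ker_of_range (kerCompToKer f g)
      (kerKerCompToKerEquiv f g).symm.finiteDimensional inferInstance
  have h₂ : FiniteDimensional ℂ (X ⧸ LinearMap.range (g ∘ₗ f)) :=
    finiteDimensional_of_ker_of_range (cokerCompToCoker f g)
      (by rw [ker_cokerCompToCoker]; infer_instance) inferInstance
  exact ⟨h₁, h₂, finrank_ker_coker_comp⟩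

theorem HasIndex.of_comp (hf : HasIndex f i) (hgf : HasIndex (g ∘ₗ f) j) :
    HasIndex g (j - i) := by
  obtain ⟨hf₁, hf₂, rfl⟩ := hf
  obtain ⟨h₁, h₂, rfl⟩ := hgf
  have hg₁ : FiniteDimensional ℂ (LinearMap.ker g) :=
    finiteDimensional_of_ker_of_range (kerToCoker f g)
      (by rw [ker_kerToCoker]; infer_instance) inferInstance
  have hg₂ : FiniteDimensional ℂ (X ⧸ LinearMap.range g) :=
    Module.Finite.of_surjective _ (surjective_cokerCompToCoker f g)
  refine ⟨hg₁, hg₂, ?_⟩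
  rw [finrank_ker_coker_comp]
  ring

end Comp

section Commensurable

theorem hasIndex_inclusion_inf_left (p q : Submodule ℂ V) [FiniteDimensional ℂ (relQuot p q)] :
    HasIndex (Submodule.inclusion (inf_le_left : p ⊓ q ≤ p)) (-finrank ℂ (relQuot p q)) := by
  have := HasIndex.of_equiv (P := PUnit) (Q := relQuot p q)
    (Submodule.inclusion (inf_le_left : p ⊓ q ≤ p))
    ((LinearEquiv.ofEq _ _ (LinearMap.ker_eq_bot.2 (Submodule.inclusion_injective _))).trans
      Submodule.botEquivPUnit)
    (Submodule.quotEquivOfEq _ _ (Submodule.range_inclusion _ _ _))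
  simpa [Module.finrank_eq_zero_of_subsingleton] using this

theorem hasIndex_inclusion_inf_right (p q : Submodule ℂ V) [FiniteDimensional ℂ (relQuot q p)] :
    HasIndex (Submodule.inclusion (inf_le_right : p ⊓ q ≤ q)) (-finrank ℂ (relQuot q p)) := by
  have := HasIndex.of_equiv (P := PUnit) (Q := relQuot q p)
    (Submodule.inclusion (inf_le_right : p ⊓ q ≤ q))
    ((LinearEquiv.ofEq _ _ (LinearMap.ker_eq_bot.2 (Submodule.inclusion_injective _))).trans
      Submodule.botEquivPUnit)
    (Submodule.quotEquivOfEq _ _ (by rw [Submodule.range_inclusion, inf_comm]))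
  simpa [Module.finrank_eq_zero_of_subsingleton] using this

/-- If `p` and `q` are commensurable and `q'` is a complement of `q`, then `p ⊓ q'` and
`V / (p ⊔ q')` are finite dimensional and the difference of their dimensions is the relative
dimension of `p` and `q`. -/
theorem finrank_inf_sub_finrank_quot_sup {p q q' : Submodule ℂ V} (h : IsCompl q q')
    [FiniteDimensional ℂ (relQuot p q)] [FiniteDimensional ℂ (relQuot q p)] :
    FiniteDimensional ℂ ↥(p ⊓ q') ∧ FiniteDimensional ℂ (V ⧸ (p ⊔ q')) ∧
      (finrank ℂ ↥(p ⊓ q') : ℤ) - finrank ℂ (V ⧸ (p ⊔ q')) =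
        (finrank ℂ (relQuot p q) : ℤ) - finrank ℂ (relQuot q p) := by
  set pr := q.projectionOnto q' h with hpr
  set g : p →ₗ[ℂ] q := pr.domRestrict p with hg
  have hgf : g ∘ₗ Submodule.inclusion (inf_le_left : p ⊓ q ≤ p) =
      Submodule.inclusion (inf_le_right : p ⊓ q ≤ q) := by
    ext x
    have := Submodule.projectionOnto_apply_left h ⟨x, x.2.2⟩
    simp [hg, hpr, this]
  have hidx : HasIndex g _ := (hasIndex_inclusion_inf_left p q).of_comp
    (hgf ▸ hasIndex_inclusion_inf_right p q)
  obtain ⟨h₁, h₂, h₃⟩ := hidx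
  have hker : LinearMap.ker g = q'.comap p.subtype := by
    ext x
    simp [hg, hpr]
  let e₁ : LinearMap.ker g ≃ₗ[ℂ] ↥(p ⊓ q') :=
    (LinearEquiv.ofEq _ _ hker).trans
      ((Submodule.equivSubtypeMap p _).trans (LinearEquiv.ofEq _ _ (by
        rw [Submodule.map_comap_subtype])))
  have hk : LinearMap.ker ((LinearMap.range g).mkQ ∘ₗ pr) = p ⊔ q' := by
    ext x
    simp only [LinearMap.mem_ker, LinearMap.comp_apply, Submodule.mkQ_apply,
      Submodule.Quotient.mk_eq_zero, LinearMap.mem_range, Submodule.mem_sup]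
    constructor
    · rintro ⟨y, hy⟩
      refine ⟨y, y.2, x - y, ?_, by abel⟩
      rw [← Submodule.ker_projectionOnto h, LinearMap.mem_ker, map_sub, ← hpr, ← hy, hg]
      simp
    · rintro ⟨y, hy, z, hz, rfl⟩
      refine ⟨⟨y, hy⟩, ?_⟩
      rw [← Submodule.ker_projectionOnto h, LinearMap.mem_ker, ← hpr] at hz
      rw [map_add, hz, add_zero, hg]
      rfl
  have hs : Function.Surjective ((LinearMap.range g).mkQ ∘ₗ pr) := by
    rw [LinearMap.coe_comp]
    exact (Submodule.mkQ_surjective _).comp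
      (LinearMap.range_eq_top.1 (Submodule.range_projectionOnto h))
  let e₂ := quotEquivOfKerEq _ _ hk hs
  refine ⟨e₁.finiteDimensional, e₂.symm.finiteDimensional, ?_⟩
  rw [← e₁.finrank_eq, e₂.finrank_eq, h₃]
  ring

end Commensurable

theorem hasIndex_prod {f : V →ₗ[ℂ] W} {g : V →ₗ[ℂ] X} (hf : Function.Surjective f)
    (hg : Function.Surjective g)
    [FiniteDimensional ℂ ↥(LinearMap.ker f ⊓ LinearMap.ker g)]
    [FiniteDimensional ℂ (V ⧸ (LinearMap.ker f ⊔ LinearMap.ker g))] :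
    HasIndex (f.prod g) (finrank ℂ ↥(LinearMap.ker f ⊓ LinearMap.ker g) -
      finrank ℂ (V ⧸ (LinearMap.ker f ⊔ LinearMap.ker g))) := by
  have hk : LinearMap.ker ((LinearMap.range (f.prod g)).mkQ ∘ₗ LinearMap.inl ℂ W X ∘ₗ f) =
      LinearMap.ker f ⊔ LinearMap.ker g := by
    ext x
    simp only [LinearMap.mem_ker, LinearMap.comp_apply, Submodule.mkQ_apply,
      Submodule.Quotient.mk_eq_zero, LinearMap.mem_range, Submodule.mem_sup, LinearMap.inl_apply,
      LinearMap.prod_apply, Prod.ext_iff, Function.prod]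
    constructor
    · rintro ⟨y, hy₁, hy₂⟩
      exact ⟨x - y, by simp [hy₁], y, hy₂, by abel⟩
    · rintro ⟨y, hy, z, hz, rfl⟩
      exact ⟨z, by simp [hy], hz⟩
  refine HasIndex.of_equiv _ (LinearEquiv.ofEq _ _ (LinearMap.ker_prod f g))
    (quotEquivOfKerEq _ _ hk ?_).symm
  intro x
  obtain ⟨⟨w, v⟩, rfl⟩ := Submodule.mkQ_surjective _ x
  obtain ⟨a, rfl⟩ := hf w
  obtain ⟨b, rfl⟩ := hg v
  refine ⟨a - b, ?_⟩
  simp only [LinearMap.comp_apply, Submodule.mkQ_apply, Submodule.Quotient.eq]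
  exact ⟨-b, by simp⟩

theorem hasIndex_coprod_subtype (p q : Submodule ℂ V) [FiniteDimensional ℂ ↥(p ⊓ q)]
    [FiniteDimensional ℂ (V ⧸ (p ⊔ q))] :
    HasIndex (p.subtype.coprod q.subtype)
      (finrank ℂ ↥(p ⊓ q) - finrank ℂ (V ⧸ (p ⊔ q))) := by
  refine HasIndex.of_equiv _ (LinearEquiv.symm (LinearEquiv.ofBijective
    (((Submodule.inclusion inf_le_left).prod (-Submodule.inclusion inf_le_right)).codRestrict
      (LinearMap.ker (p.subtype.coprod q.subtype)) fun x => by simp) ⟨?_, ?_⟩))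
    (Submodule.quotEquivOfEq _ _ (by simp [LinearMap.range_coprod]))
  · intro x y hxy
    exact Subtype.ext (congrArg (fun z => ((LinearMap.ker _).subtype z).1.1) hxy)
  · rintro ⟨⟨x, y⟩, hxy⟩
    have hxy' : (x : V) = -y := by
      simpa [add_eq_zero_iff_eq_neg] using hxy
    refine ⟨⟨x, x.2, by rw [hxy']; exact q.neg_mem y.2⟩, ?_⟩
    exact Subtype.ext (Prod.ext rfl (Subtype.ext (by simp [hxy'])))

end AlgebraicIndex

section HilbertPair

variable {X Y : Type*} [NormedAddCommGroup X] [InnerProductSpace ℂ X] [CompleteSpace X]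
  [NormedAddCommGroup Y] [InnerProductSpace ℂ Y] [CompleteSpace Y]

/-- A bounded operator between Hilbert spaces whose range has finite codimension has closed
range. -/
theorem isClosed_range_of_finiteDimensional_quotient (f : X →L[ℂ] Y)
    [FiniteDimensional ℂ (Y ⧸ LinearMap.range f.toLinearMap)] :
    IsClosed (LinearMap.range f.toLinearMap : Set Y) := by
  obtain ⟨G, hG⟩ := Submodule.exists_isCompl (LinearMap.range f.toLinearMap)
  have : FiniteDimensional ℂ G :=
    (Submodule.quotientEquivOfIsCompl _ _ hG).finiteDimensional
  set K := LinearMap.ker f.toLinearMap with hK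
  have hKc : IsClosed (K : Set X) := f.isClosed_ker
  have : CompleteSpace K := hKc.completeSpace_coe
  have hr : LinearMap.range (f ∘L Kᗮ.subtypeL).toLinearMap = LinearMap.range f.toLinearMap := by
    refine le_antisymm (LinearMap.range_comp_le_range _ _) ?_
    rintro _ ⟨x, rfl⟩
    obtain ⟨y, hy, z, hz, rfl⟩ := K.exists_add_mem_mem_orthogonal x
    refine ⟨⟨z, hz⟩, ?_⟩
    have hy : f y = 0 := hy
    simp [hy]
  rw [← hr]
  refine closed_complemented_range_of_isCompl_of_ker_eq_bot (f ∘L Kᗮ.subtypeL) G (hr ▸ hG)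
    G.closed_of_finiteDimensional ?_
  rw [LinearMap.ker_eq_bot']
  intro x hx
  have hx' : (x : X) ∈ K := hx
  exact Subtype.ext ((Submodule.disjoint_def.1 K.orthogonal_disjoint) x hx' x.2)

/-- The closed range theorem: if `f` has closed range then the range of its adjoint is the
orthogonal complement of its kernel. -/
theorem range_adjoint_eq_orthogonal_ker (f : X →L[ℂ] Y)
    (hf : IsClosed (LinearMap.range f.toLinearMap : Set Y)) :
    LinearMap.range (adjoint f).toLinearMap = (LinearMap.ker f.toLinearMap)ᗮ := by
  refine le_antisymm ?_ ?_
  · rw [f.orthogonal_ker]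
    exact Submodule.le_topologicalClosure _
  set K := LinearMap.ker f.toLinearMap with hK
  have hKc : IsClosed (K : Set X) := f.isClosed_ker
  have : CompleteSpace K := hKc.completeSpace_coe
  have : CompleteSpace (LinearMap.range f.toLinearMap) := hf.completeSpace_coe
  let φ : Kᗮ →L[ℂ] LinearMap.range f.toLinearMap :=
    (f ∘L Kᗮ.subtypeL).codRestrict _ fun x => ⟨x, rfl⟩
  have hφ₁ : LinearMap.ker φ.toLinearMap = ⊥ := by
    rw [LinearMap.ker_eq_bot']
    intro x hx
    have hx' : (x : X) ∈ K := congrArg Subtype.val hx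
    exact Subtype.ext ((Submodule.disjoint_def.1 K.orthogonal_disjoint) x hx' x.2)
  have hφ₂ : LinearMap.range φ.toLinearMap = ⊤ := by
    rw [LinearMap.range_eq_top]
    rintro ⟨_, x, rfl⟩
    obtain ⟨y, hy, z, hz, rfl⟩ := K.exists_add_mem_mem_orthogonal x
    refine ⟨⟨z, hz⟩, Subtype.ext ?_⟩
    have hy : f y = 0 := hy
    change f z = f (y + z)
    rw [map_add, hy, zero_add]
  let Φ := ContinuousLinearEquiv.ofBijective φ hφ₁ hφ₂
  intro v hv
  refine ⟨adjoint (Φ.symm : LinearMap.range f.toLinearMap →L[ℂ] Kᗮ) ⟨v, hv⟩, ?_⟩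
  refine ext_inner_right ℂ fun x => ?_
  obtain ⟨y, hy, z, hz, rfl⟩ := K.exists_add_mem_mem_orthogonal x
  have hfy : f y = 0 := hy
  have hfz : f z = (Φ ⟨z, hz⟩ : Y) := rfl
  have hvy : inner ℂ v y = 0 := (Submodule.mem_orthogonal' K v).1 hv y hy
  rw [ContinuousLinearMap.coe_coe, adjoint_inner_left, map_add, hfy, zero_add, hfz,
    ← Submodule.coe_inner, adjoint_inner_left, inner_add_right, hvy, zero_add]
  simp

/-- The orthogonal complement of a closed subspace is isomorphic to the quotient. -/
def orthogonalEquivQuotient (K : Submodule ℂ X) (hK : IsClosed (K : Set X)) :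
    (X ⧸ K) ≃ₗ[ℂ] Kᗮ :=
  have : CompleteSpace K := hK.completeSpace_coe
  Submodule.quotientEquivOfIsCompl _ _ K.isCompl_orthogonal

theorem isFredholmOp_iff (f : X →L[ℂ] Y) :
    IsFredholmOp f ↔ ∃ i, HasIndex f.toLinearMap i :=
  ⟨fun h => ⟨_, h.1, h.2.2, rfl⟩, fun ⟨_, h⟩ =>
    have := h.2.1
    ⟨h.1, isClosed_range_of_finiteDimensional_quotient f, h.2.1⟩⟩

theorem HasIndex.isFredholmOp {f : X →L[ℂ] Y} {i : ℤ} (h : HasIndex f.toLinearMap i) :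
    IsFredholmOp f :=
  (isFredholmOp_iff f).2 ⟨i, h⟩

theorem IsFredholmOp.hasIndex_adjoint {f : X →L[ℂ] Y} (h : IsFredholmOp f) :
    HasIndex (adjoint f).toLinearMap (-opIndex f) := by
  obtain ⟨h₁, h₂, h₃⟩ := h
  have e₁ : LinearMap.ker (adjoint f).toLinearMap ≃ₗ[ℂ] Y ⧸ LinearMap.range f.toLinearMap :=
    (LinearEquiv.ofEq _ _ f.orthogonal_range.symm).trans (orthogonalEquivQuotient _ h₂).symm
  have hK : IsCompl (LinearMap.ker f.toLinearMap)ᗮ (LinearMap.ker f.toLinearMap) := by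
    have : CompleteSpace (LinearMap.ker f.toLinearMap) := f.isClosed_ker.completeSpace_coe
    exact (Submodule.isCompl_orthogonal _).symm
  have e₂ : (X ⧸ LinearMap.range (adjoint f).toLinearMap) ≃ₗ[ℂ] LinearMap.ker f.toLinearMap :=
    (Submodule.quotEquivOfEq _ _ (range_adjoint_eq_orthogonal_ker f h₂)).trans
      (Submodule.quotientEquivOfIsCompl _ _ hK)
  have := HasIndex.of_equiv _ e₁ e₂
  rwa [opIndex, neg_sub]

/-- If the range of `E` is commensurable with a closed subspace then it is closed. -/
theorem isClosed_range_of_commensurable (E : Y →L[ℂ] X) (N : Submodule ℂ X)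
    (hN : IsClosed (N : Set X))
    [FiniteDimensional ℂ (relQuot N (LinearMap.range E.toLinearMap))]
    [FiniteDimensional ℂ (relQuot (LinearMap.range E.toLinearMap) N)] :
    IsClosed (LinearMap.range E.toLinearMap : Set X) := by
  set K := N.comap E.toLinearMap with hK
  have hKc : IsClosed (K : Set Y) := hN.preimage E.continuous
  have : CompleteSpace K := hKc.completeSpace_coe
  have : CompleteSpace N := hN.completeSpace_coe
  let g : K →L[ℂ] N := (E ∘L K.subtypeL).codRestrict N fun x => x.2
  have hg : LinearMap.range g.toLinearMap =
      (N ⊓ LinearMap.range E.toLinearMap).comap N.subtype := by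
    ext x
    constructor
    · rintro ⟨y, rfl⟩
      exact ⟨(g y).2, y, rfl⟩
    · rintro ⟨-, y, hy⟩
      refine ⟨⟨y, ?_⟩, Subtype.ext hy⟩
      have : E.toLinearMap y ∈ N := by rw [hy]; exact x.2
      exact this
  have : FiniteDimensional ℂ (N ⧸ LinearMap.range g.toLinearMap) :=
    (Submodule.quotEquivOfEq _ _ hg).symm.finiteDimensional
  have hgc := isClosed_range_of_finiteDimensional_quotient g
  have hmap : IsClosed (K.map E.toLinearMap : Set X) := by
    have : (K.map E.toLinearMap : Set X) =
        N.subtype '' (LinearMap.range g.toLinearMap : Set N) := by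
      rw [hg, ← Submodule.map_coe, Submodule.map_comap_subtype, hK, Submodule.map_comap_eq,
        inf_comm, inf_left_idem]
    rw [this]
    exact hN.isClosedEmbedding_subtypeVal.isClosedMap _ hgc
  have hk : LinearMap.ker (((LinearMap.range E.toLinearMap ⊓ N).comap
      (LinearMap.range E.toLinearMap).subtype).mkQ ∘ₗ E.toLinearMap.rangeRestrict) = K := by
    ext x
    rw [LinearMap.mem_ker, LinearMap.comp_apply, Submodule.mkQ_apply,
      Submodule.Quotient.mk_eq_zero]
    exact ⟨fun hx => hx.2, fun hx => ⟨⟨x, rfl⟩, hx⟩⟩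
  have hs : Function.Surjective (((LinearMap.range E.toLinearMap ⊓ N).comap
      (LinearMap.range E.toLinearMap).subtype).mkQ ∘ₗ E.toLinearMap.rangeRestrict) :=
    (Submodule.mkQ_surjective _).comp E.toLinearMap.surjective_rangeRestrict
  have : FiniteDimensional ℂ (Y ⧸ K) := (quotEquivOfKerEq _ _ hk hs).symm.finiteDimensional
  exact LinearMap.isClosed_range_of_isClosed_map_of_finiteDimensional_quotient hmap

/-- For a Fredholm pair `(D, E)` the operator `D + E*` is Fredholm, with the same index. -/
theorem IsFredholmPair.hasIndex {D : X →L[ℂ] Y} {E : Y →L[ℂ] X} (h : IsFredholmPair D E) :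
    HasIndex (D + adjoint E).toLinearMap (pairIndex D E) := by
  obtain ⟨h₁, h₂, h₃, h₄⟩ := h
  have hEc := isClosed_range_of_commensurable E _ D.isClosed_ker
  have : CompleteSpace (LinearMap.range E.toLinearMap) := hEc.completeSpace_coe
  have : CompleteSpace (LinearMap.ker E.toLinearMap) := E.isClosed_ker.completeSpace_coe
  have hadj := range_adjoint_eq_orthogonal_ker E hEc
  let β : X →ₗ[ℂ] (LinearMap.ker E.toLinearMap)ᗮ :=
    (adjoint E).toLinearMap.codRestrict _ fun x => hadj ▸ ⟨x, rfl⟩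
  have hβ : Function.Surjective β := by
    rintro ⟨y, hy⟩
    rw [← hadj] at hy
    obtain ⟨x, rfl⟩ := hy
    exact ⟨x, rfl⟩
  have hkα : LinearMap.ker D.toLinearMap.rangeRestrict = LinearMap.ker D.toLinearMap :=
    LinearMap.ker_rangeRestrict _
  have hkβ : LinearMap.ker β = (LinearMap.range E.toLinearMap)ᗮ := by
    rw [LinearMap.ker_codRestrict]
    exact E.orthogonal_range.symm
  obtain ⟨a₁, a₂, a₃⟩ := finrank_inf_sub_finrank_quot_sup (p := LinearMap.ker D.toLinearMap)
    (Submodule.isCompl_orthogonal (LinearMap.range E.toLinearMap))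
  obtain ⟨b₁, b₂, b₃⟩ := finrank_inf_sub_finrank_quot_sup (p := LinearMap.range D.toLinearMap)
    (Submodule.isCompl_orthogonal (LinearMap.ker E.toLinearMap))
  rw [← hkβ, ← hkα] at a₁ a₂ a₃
  have hS := hasIndex_prod D.toLinearMap.surjective_rangeRestrict hβ
  have hT := hasIndex_coprod_subtype (LinearMap.range D.toLinearMap)
    (LinearMap.ker E.toLinearMap)ᗮ
  have hcomp : (D + adjoint E).toLinearMap =
      ((LinearMap.range D.toLinearMap).subtype.coprod (LinearMap.ker E.toLinearMap)ᗮ.subtype) ∘ₗ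
        (D.toLinearMap.rangeRestrict.prod β) := by
    ext x
    simp [β]
  have := hT.comp hS
  rw [← hcomp, a₃, b₃, hkα] at this
  convert this using 1
  rw [pairIndex]
  ring

/-- If `p` is a closed subspace, `q` is contained in `p` up to finite dimension, and `q + pᗮ` has
finite codimension, then `q` contains `p` up to finite dimension. -/
theorem finiteDimensional_relQuot_of_sup_orthogonal {p q : Submodule ℂ X}
    (hp : IsClosed (p : Set X)) [FiniteDimensional ℂ (relQuot q p)]
    [FiniteDimensional ℂ (X ⧸ (q ⊔ pᗮ))] : FiniteDimensional ℂ (relQuot p q) := by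
  have : CompleteSpace p := hp.completeSpace_coe
  have hc := p.isCompl_orthogonal
  set pr := p.projectionOnto pᗮ hc with hpr
  have hle : q ⊔ pᗮ ≤ ((q.map pr)).comap pr := by
    refine sup_le (fun x hx => ⟨x, hx, rfl⟩) fun x hx => ?_
    rw [← Submodule.ker_projectionOnto hc] at hx
    rw [Submodule.mem_comap, LinearMap.mem_ker.1 hx]
    exact Submodule.zero_mem _
  have h₁ : FiniteDimensional ℂ (p ⧸ q.map pr) := by
    refine Module.Finite.of_surjective (Submodule.mapQ (q ⊔ pᗮ) (q.map pr) pr hle) ?_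
    intro x
    obtain ⟨x, rfl⟩ := Submodule.mkQ_surjective _ x
    exact ⟨Submodule.Quotient.mk x, by
      rw [Submodule.mapQ_apply, hpr, Submodule.projectionOnto_apply_left]; rfl⟩
  set r := (p ⊓ q).comap p.subtype with hr
  have hqr : (q ⊓ p).comap q.subtype ≤ r.comap (pr.domRestrict q) := by
    rintro x ⟨hx₁, hx₂⟩
    have : pr x = ⟨x, hx₂⟩ := Submodule.projectionOnto_apply_left hc ⟨x, hx₂⟩
    rw [Submodule.mem_comap, LinearMap.domRestrict_apply, this]
    exact ⟨hx₂, hx₁⟩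
  have hrq : r ≤ q.map pr := fun x hx =>
    ⟨x, hx.2, Submodule.projectionOnto_apply_left hc x⟩
  refine finiteDimensional_of_ker_of_range (Submodule.factor hrq) ?_ inferInstance
  have hker : LinearMap.ker (Submodule.factor hrq) ≤
      LinearMap.range (Submodule.mapQ _ _ (pr.domRestrict q) hqr) := by
    intro x hx
    obtain ⟨x, rfl⟩ := Submodule.mkQ_surjective _ x
    have hx : (Submodule.Quotient.mk x : p ⧸ q.map pr) = 0 := hx
    rw [Submodule.Quotient.mk_eq_zero] at hx
    obtain ⟨y, hy, rfl⟩ := hx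
    exact ⟨Submodule.Quotient.mk ⟨y, hy⟩, rfl⟩
  exact Submodule.finiteDimensional_of_le hker

theorem IsFredholmOp.finiteDimensional_relQuot {D : X →L[ℂ] Y} {E : Y →L[ℂ] X}
    (h : IsFredholmOp (D + adjoint E))
    [FiniteDimensional ℂ (relQuot (LinearMap.range D.toLinearMap) (LinearMap.ker E.toLinearMap))] :
    FiniteDimensional ℂ (relQuot (LinearMap.ker E.toLinearMap) (LinearMap.range D.toLinearMap)) := by
  have hle : LinearMap.range (D + adjoint E).toLinearMap ≤
      LinearMap.range D.toLinearMap ⊔ (LinearMap.ker E.toLinearMap)ᗮ := by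
    rintro _ ⟨x, rfl⟩
    refine Submodule.add_mem_sup ⟨x, rfl⟩ ?_
    rw [E.orthogonal_ker]
    exact Submodule.le_topologicalClosure _ ⟨x, rfl⟩
  have := h.2.2
  have : FiniteDimensional ℂ
      (Y ⧸ (LinearMap.range D.toLinearMap ⊔ (LinearMap.ker E.toLinearMap)ᗮ)) :=
    Module.Finite.of_surjective _ (Submodule.factor_surjective hle)
  exact finiteDimensional_relQuot_of_sup_orthogonal E.isClosed_ker

/-- If `DE` and `ED` have finite rank then `(D, E)` is a Fredholm pair if and only if `D + E*` is
a Fredholm operator. -/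
theorem isFredholmPair_iff_isFredholmOp {D : X →L[ℂ] Y} {E : Y →L[ℂ] X}
    [FiniteDimensional ℂ (relQuot (LinearMap.range D.toLinearMap) (LinearMap.ker E.toLinearMap))]
    [FiniteDimensional ℂ (relQuot (LinearMap.range E.toLinearMap) (LinearMap.ker D.toLinearMap))] :
    IsFredholmPair D E ↔ IsFredholmOp (D + adjoint E) := by
  refine ⟨fun h => h.hasIndex.isFredholmOp, fun h => ?_⟩
  have h' : IsFredholmOp (E + adjoint D) := by
    have := h.hasIndex_adjoint.isFredholmOp
    rwa [map_add, adjoint_adjoint, add_comm] at this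
  exact ⟨h'.finiteDimensional_relQuot, inferInstance, h.finiteDimensional_relQuot, inferInstance⟩

end HilbertPair

section LpFamily

/-- A finitely supported Hilbert sum contains every family. -/
theorem exists_lp_eq {κ : Type*} {F : κ → Type*} [∀ k, NormedAddCommGroup (F k)]
    {s : Finset κ} (hs : ∀ k, k ∉ s → Subsingleton (F k)) (f : ∀ k, F k) :
    ∃ y : lp F 2, ∀ k, y k = f k := by
  have hf : Memℓp f 2 := by
    refine (memℓp_zero (s.finite_toSet.subset fun k hk => ?_)).of_exponent_ge zero_le
    by_contra hks
    have := hs k hks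
    exact hk (Subsingleton.elim _ _)
  exact ⟨⟨f, hf⟩, fun _ => rfl⟩

variable {ι κ : Type*}
  {G : ι → Type*} [∀ i, NormedAddCommGroup (G i)] [∀ i, InnerProductSpace ℂ (G i)]
  {F : κ → Type*} [∀ k, NormedAddCommGroup (F k)] [∀ k, InnerProductSpace ℂ (F k)]

/-- A family of operators into a finitely supported Hilbert sum is induced by one operator. -/
theorem exists_lp_operator [DecidableEq κ] {s : Finset κ} (hs : ∀ k, k ∉ s → Subsingleton (F k)) (σ : κ → ι)
    (T : ∀ k, G (σ k) →L[ℂ] F k) :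
    ∃ S : lp G 2 →L[ℂ] lp F 2, ∀ x k, S x k = T k (x (σ k)) := by
  refine ⟨∑ k ∈ s, lp.singleContinuousLinearMap ℂ F 2 k ∘L T k ∘L lp.evalCLM ℂ G 2 (σ k),
    fun x k => ?_⟩
  by_cases hk : k ∈ s
  · rw [sum_apply, lp.coeFn_sum, Finset.sum_apply, Finset.sum_eq_single k]
    · exact lp.single_apply_self _ _ _
    · intro j _ hj
      exact lp.single_apply_ne _ _ _ hj.symm
    · exact fun h => absurd hk h
  · have := hs k hk
    exact Subsingleton.elim _ _

section Diagonal

variable {S : lp G 2 →L[ℂ] lp F 2} {σ : κ ≃ ι} {T : ∀ k, G (σ k) →L[ℂ] F k}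

theorem lp_adjoint_apply [DecidableEq ι] [∀ i, CompleteSpace (G i)] [∀ k, CompleteSpace (F k)]
    (hS : ∀ x k, S x k = T k (x (σ k))) (y : lp F 2) (k : κ) :
    (adjoint S y) (σ k) = adjoint (T k) (y k) := by
  refine ext_inner_left ℂ fun v => ?_
  rw [← lp.inner_single_left, adjoint_inner_right, adjoint_inner_right, lp.inner_eq_tsum,
    tsum_eq_single k]
  · rw [hS, lp.single_apply_self]
  · intro j hj
    rw [hS, lp.single_apply_ne _ _ _ (σ.injective.ne hj), map_zero, inner_zero_left]

theorem mem_ker_lp (hS : ∀ x k, S x k = T k (x (σ k))) (x : lp G 2) :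
    x ∈ LinearMap.ker S.toLinearMap ↔ ∀ k, x (σ k) ∈ LinearMap.ker (T k).toLinearMap := by
  simp only [LinearMap.mem_ker, ContinuousLinearMap.coe_coe, ← hS]
  constructor
  · intro h k
    rw [h]
    rfl
  · intro h
    ext k
    exact h k

theorem mem_range_lp {s : Finset ι} (hs : ∀ i, i ∉ s → Subsingleton (G i))
    (hS : ∀ x k, S x k = T k (x (σ k))) (y : lp F 2) :
    y ∈ LinearMap.range S.toLinearMap ↔ ∀ k, y k ∈ LinearMap.range (T k).toLinearMap := by
  constructor
  · rintro ⟨x, rfl⟩ k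
    exact ⟨x (σ k), (hS x k).symm⟩
  · intro h
    choose v hv using h
    have hcast : ∀ i, ∃ w : G i, ∀ k, ∀ hk : σ k = i, T k (hk ▸ w) = y k := by
      intro i
      obtain ⟨k, rfl⟩ := σ.surjective i
      refine ⟨v k, fun j hj => ?_⟩
      obtain rfl := σ.injective hj
      exact hv j
    choose w hw using hcast
    obtain ⟨x, hx⟩ := exists_lp_eq hs w
    refine ⟨x, ?_⟩
    ext k
    rw [ContinuousLinearMap.coe_coe, hS, hx]
    exact hw _ k rfl

end Diagonal

section RelQuot

variable {s : Finset κ} {P Q : Submodule ℂ (lp F 2)} {p q : ∀ k, Submodule ℂ (F k)}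

/-- Relative quotients of a finitely supported Hilbert sum are computed componentwise. -/
theorem nonempty_relQuot_equiv_pi (hs : ∀ k, k ∉ s → Subsingleton (F k))
    (hP : ∀ x, x ∈ P ↔ ∀ k, x k ∈ p k) (hQ : ∀ x, x ∈ Q ↔ ∀ k, x k ∈ q k) :
    Nonempty (relQuot P Q ≃ₗ[ℂ] ∀ k : s, relQuot (p k) (q k)) := by
  classical
  let comp : ∀ k, P →ₗ[ℂ] p k := fun k =>
    ((lp.evalCLM ℂ F 2 k).toLinearMap ∘ₗ P.subtype).codRestrict (p k)
      fun x => (hP x).1 x.2 k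
  have hcomp : ∀ k x, (comp k x : F k) = (x : lp F 2) k := fun _ _ => rfl
  let f : P →ₗ[ℂ] ∀ k : s, relQuot (p k) (q k) :=
    LinearMap.pi fun k => (Submodule.mkQ _) ∘ₗ comp k
  refine ⟨quotEquivOfKerEq f _ ?_ ?_⟩
  · ext x
    simp only [f, LinearMap.mem_ker, funext_iff, LinearMap.pi_apply, LinearMap.comp_apply,
      Submodule.mkQ_apply, Submodule.Quotient.mk_eq_zero, Submodule.mem_comap,
      Submodule.subtype_apply, Submodule.mem_inf, hcomp, Pi.zero_apply, hQ]
    constructor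
    · intro h
      refine ⟨x.2, fun k => ?_⟩
      by_cases hk : k ∈ s
      · exact (h ⟨k, hk⟩).2
      · have := hs k hk
        rw [Subsingleton.elim ((x : lp F 2) k) 0]
        exact zero_mem _
    · exact fun h k => ⟨(hP x).1 x.2 k, h.2 k⟩
  · intro y
    choose v hv using fun k : s => Submodule.mkQ_surjective _ (y k)
    obtain ⟨x, hx⟩ := exists_lp_eq hs
      fun k => if hk : k ∈ s then (v ⟨k, hk⟩ : F k) else 0
    have hxP : x ∈ P := by
      refine (hP x).2 fun k => ?_
      rw [hx]
      split_ifs with hk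
      · exact (v ⟨k, hk⟩).2
      · exact zero_mem _
    refine ⟨⟨x, hxP⟩, funext fun k => ?_⟩
    rw [← hv k]
    change Submodule.mkQ _ (comp k ⟨x, hxP⟩) = _
    congr 1
    ext
    rw [hcomp, hx, dif_pos k.2]

theorem finiteDimensional_relQuot_lp_iff (hs : ∀ k, k ∉ s → Subsingleton (F k))
    (hP : ∀ x, x ∈ P ↔ ∀ k, x k ∈ p k) (hQ : ∀ x, x ∈ Q ↔ ∀ k, x k ∈ q k) :
    FiniteDimensional ℂ (relQuot P Q) ↔ ∀ k, FiniteDimensional ℂ (relQuot (p k) (q k)) := by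
  obtain ⟨e⟩ := nonempty_relQuot_equiv_pi hs hP hQ
  constructor
  · intro h k
    by_cases hk : k ∈ s
    · have : FiniteDimensional ℂ (∀ k : s, relQuot (p k) (q k)) := Module.Finite.equiv e
      exact Module.Finite.of_surjective
        (LinearMap.proj (R := ℂ) (φ := fun k : s => relQuot (p k) (q k)) ⟨k, hk⟩)
        (Function.surjective_eval _)
    · have := hs k hk
      infer_instance
  · intro h
    exact Module.Finite.equiv e.symm

theorem finrank_relQuot_lp (hs : ∀ k, k ∉ s → Subsingleton (F k))
    (hP : ∀ x, x ∈ P ↔ ∀ k, x k ∈ p k) (hQ : ∀ x, x ∈ Q ↔ ∀ k, x k ∈ q k)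
    (h : FiniteDimensional ℂ (relQuot P Q)) :
    finrank ℂ (relQuot P Q) = ∑ k ∈ s, finrank ℂ (relQuot (p k) (q k)) := by
  have := (finiteDimensional_relQuot_lp_iff hs hP hQ).1 h
  obtain ⟨e⟩ := nonempty_relQuot_equiv_pi hs hP hQ
  rw [e.finrank_eq, Module.finrank_pi_fintype,
    Finset.sum_coe_sort s fun k => finrank ℂ (relQuot (p k) (q k))]

end RelQuot

end LpFamily

/-- Alternating sums over `0, …, n` in terms of the even and the odd indices. -/
theorem sum_range_neg_one_pow_mul (c : ℤ → ℤ) (n : ℕ)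
    (hc : ∀ p : ℤ, (p < 0 ∨ (n : ℤ) + 1 ≤ p) → c p = 0) :
    ∑ j ∈ Finset.range (n + 1), (-1 : ℤ) ^ j * c j =
      ∑ k ∈ Finset.Icc (-(n + 1 : ℤ)) (n + 1), c (2 * k) -
        ∑ k ∈ Finset.Icc (-(n + 1 : ℤ)) (n + 1), c (2 * k - 1) := by
  have heven : ∑ j ∈ Finset.range (n + 1) with Even j, (-1 : ℤ) ^ j * c j =
      ∑ k ∈ Finset.Icc (-(n + 1 : ℤ)) (n + 1), c (2 * k) := by
    refine Finset.sum_of_injOn (fun j : ℕ => (j : ℤ) / 2) ?_ ?_ ?_ ?_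
    · intro a ha b hb hab
      simp only [Finset.coe_filter, Set.mem_ofPred_eq, Nat.even_iff] at ha hb hab
      omega
    · intro a ha
      simp only [Finset.coe_filter, Finset.mem_range, Set.mem_ofPred_eq, Nat.even_iff,
        Finset.coe_Icc, Set.mem_Icc] at ha ⊢
      omega
    · intro k _ hk
      refine hc _ ?_
      by_contra! h
      refine hk ⟨(2 * k).toNat, ?_, ?_⟩
      · simp only [Finset.coe_filter, Finset.mem_range, Set.mem_ofPred_eq, Nat.even_iff]
        omega
      · dsimp only
        omega
    · intro j hj
      have hj' := (Finset.mem_filter.1 hj).2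
      rw [hj'.neg_one_pow, one_mul]
      rw [Nat.even_iff] at hj'
      congr 1
      omega
  have hodd : ∑ j ∈ Finset.range (n + 1) with ¬ Even j, -((-1 : ℤ) ^ j * c j) =
      ∑ k ∈ Finset.Icc (-(n + 1 : ℤ)) (n + 1), c (2 * k - 1) := by
    refine Finset.sum_of_injOn (fun j : ℕ => ((j : ℤ) + 1) / 2) ?_ ?_ ?_ ?_
    · intro a ha b hb hab
      simp only [Finset.coe_filter, Set.mem_ofPred_eq, Nat.even_iff] at ha hb hab
      omega
    · intro a ha
      simp only [Finset.coe_filter, Finset.mem_range, Set.mem_ofPred_eq, Nat.even_iff,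
        Finset.coe_Icc, Set.mem_Icc] at ha ⊢
      omega
    · intro k _ hk
      refine hc _ ?_
      by_contra! h
      refine hk ⟨(2 * k - 1).toNat, ?_, ?_⟩
      · simp only [Finset.coe_filter, Finset.mem_range, Set.mem_ofPred_eq, Nat.even_iff]
        omega
      · dsimp only
        omega
    · intro j hj
      have hj' := (Finset.mem_filter.1 hj).2
      rw [(Nat.not_even_iff_odd.1 hj').neg_one_pow, neg_one_mul, neg_neg]
      rw [Nat.even_iff] at hj'
      congr 1
      omega
  rw [← heven, ← hodd, Finset.sum_neg_distrib, sub_neg_eq_add,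
    Finset.sum_filter_add_sum_filter_not]

section Chain

variable (H : ℤ → Type*) [∀ p, NormedAddCommGroup (H p)] [∀ p, InnerProductSpace ℂ (H p)]

theorem fcast_congr {x : ∀ k : ℤ, H (2 * k)} {a b q : ℤ} (hab : a = b) (ha : 2 * a = q)
    (hb : 2 * b = q) : fcast H ha (x a) = fcast H hb (x b) := by
  subst hab
  rfl

variable (δ : ∀ p : ℤ, H p →L[ℂ] H (p - 1))

theorem mem_ker_fcast {p q r : ℤ} (h : p = q) (h' : q - 1 = r) (v : H p) :
    v ∈ LinearMap.ker (fcastL H h' ∘L δ q ∘L fcastL H h).toLinearMap ↔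
      v ∈ LinearMap.ker (δ p).toLinearMap := by
  subst h
  subst h'
  rfl

theorem adjoint_fcast_apply [∀ p, CompleteSpace (H p)] {p q r : ℤ} (h : p = q)
    (h' : q - 1 = r) (h'' : r = p - 1) (v : H r) :
    adjoint (fcastL H h' ∘L δ q ∘L fcastL H h) v = adjoint (δ p) (fcast H h'' v) := by
  subst h
  subst h'
  rfl

theorem range_fcast_eq_chainRange {p r : ℤ} (h : p = r + 1) (h' : r + 1 - 1 = r) :
    LinearMap.range (fcastL H h' ∘L δ (r + 1) ∘L fcastL H h).toLinearMap =
      chainRange H δ r := by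
  subst h
  exact LinearMap.range_comp (δ (r + 1)).toLinearMap (fcastL H h').toLinearMap

theorem range_eq_chainRange (p : ℤ) :
    LinearMap.range (δ p).toLinearMap = chainRange H δ (p - 1) := by
  have key : ∀ (q : ℤ) (h : q = p) (h' : q - 1 = p - 1), LinearMap.range (δ p).toLinearMap =
      Submodule.map (fcastL H h').toLinearMap (LinearMap.range (δ q).toLinearMap) := by
    intro q h h'
    subst h
    exact (Submodule.map_id _).symm
  exact key _ (by ring) _

theorem finiteDimensional_relQuot_chainRange {p : ℤ}
    (h : FiniteDimensional ℂ (LinearMap.range (chainComp H δ p).toLinearMap)) :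
    FiniteDimensional ℂ
      (relQuot (chainRange H δ p) (LinearMap.ker (δ p).toLinearMap)) := by
  let f := (δ p).toLinearMap.domRestrict (chainRange H δ p)
  have hrange : LinearMap.range f = LinearMap.range (chainComp H δ p).toLinearMap := by
    rw [LinearMap.range_domRestrict, chainRange, ← LinearMap.range_comp,
      ← LinearMap.range_comp]
    rfl
  have : FiniteDimensional ℂ (LinearMap.range f) := hrange ▸ h
  refine Module.Finite.equiv (quotEquivOfKerEq f.rangeRestrict _ ?_
    f.surjective_rangeRestrict).symm
  ext x
  simp [f]

theorem isFredholmChain_iff_even_odd :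
    IsFredholmChain H δ ↔
      (∀ k : ℤ, FiniteDimensional ℂ
          (relQuot (LinearMap.ker (δ (2 * k)).toLinearMap) (chainRange H δ (2 * k))) ∧
        FiniteDimensional ℂ
          (relQuot (chainRange H δ (2 * k)) (LinearMap.ker (δ (2 * k)).toLinearMap))) ∧
      ∀ k : ℤ, FiniteDimensional ℂ
          (relQuot (LinearMap.ker (δ (2 * k - 1)).toLinearMap) (chainRange H δ (2 * k - 1))) ∧
        FiniteDimensional ℂ
          (relQuot (chainRange H δ (2 * k - 1))
            (LinearMap.ker (δ (2 * k - 1)).toLinearMap)) := by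
  refine ⟨fun h => ⟨fun k => h _, fun k => h _⟩, fun h p => ?_⟩
  obtain ⟨k, rfl | rfl⟩ : ∃ k : ℤ, p = 2 * k ∨ p = 2 * k - 1 := ⟨(p + 1) / 2, by omega⟩
  · exact h.1 k
  · exact h.2 k

end Chain

theorem fredholm_chain_tfae (H : ℤ → Type) [∀ p, NormedAddCommGroup (H p)]
    [∀ p, InnerProductSpace ℂ (H p)] [∀ p, CompleteSpace (H p)] (n : ℕ)
    (hzero : ∀ p : ℤ, (p < 0 ∨ (n : ℤ) + 1 ≤ p) → Subsingleton (H p))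
    (δ : ∀ p : ℤ, H p →L[ℂ] H (p - 1))
    (hcomp : ∀ p : ℤ, FiniteDimensional ℂ (LinearMap.range (chainComp H δ p).toLinearMap))
    (A : lp (fun k : ℤ => H (2 * k)) 2 →L[ℂ] lp (fun k : ℤ => H (2 * k - 1)) 2)
    (B : lp (fun k : ℤ => H (2 * k - 1)) 2 →L[ℂ] lp (fun k : ℤ => H (2 * k)) 2)
    (hA : ∀ (x : lp (fun k : ℤ => H (2 * k)) 2) (k : ℤ),
      A x k = δ (2 * k) (x k) +
        adjoint (δ (2 * k - 1)) (fcast H (show 2 * (k - 1) = 2 * k - 1 - 1 by ring) (x (k - 1))))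
    (hB : ∀ (y : lp (fun k : ℤ => H (2 * k - 1)) 2) (k : ℤ),
      B y k = fcast H (show 2 * k + 1 - 1 = 2 * k by ring)
          (δ (2 * k + 1) (fcast H (show 2 * (k + 1) - 1 = 2 * k + 1 by ring) (y (k + 1))))
        + adjoint (δ (2 * k)) (y k)) :
    ([IsFredholmChain H δ, IsFredholmOp A, IsFredholmOp B].TFAE) ∧
    (IsFredholmChain H δ →
      chainIndex H δ n = opIndex A ∧ opIndex A = - opIndex B) := by
  let s : Finset ℤ := Finset.Icc (-(n + 1 : ℤ)) (n + 1)
  have hsX : ∀ k, k ∉ s → Subsingleton (H (2 * k)) := fun k hk =>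
    hzero _ (by simp only [s, Finset.mem_Icc] at hk; omega)
  have hsY : ∀ k, k ∉ s → Subsingleton (H (2 * k - 1)) := fun k hk =>
    hzero _ (by simp only [s, Finset.mem_Icc] at hk; omega)
  let σ : ℤ ≃ ℤ := Equiv.addRight 1
  let T : ∀ k : ℤ, H (2 * σ k - 1) →L[ℂ] H (2 * k) := fun k =>
    fcastL H (show 2 * k + 1 - 1 = 2 * k by ring) ∘L δ (2 * k + 1) ∘L
      fcastL H (show 2 * (k + 1) - 1 = 2 * k + 1 by ring)
  obtain ⟨D, hD⟩ : ∃ D : lp (fun k : ℤ => H (2 * k)) 2 →L[ℂ] lp (fun k : ℤ => H (2 * k - 1)) 2,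
      ∀ x k, D x k = δ (2 * k) (x (Equiv.refl ℤ k)) :=
    exists_lp_operator (G := fun k : ℤ => H (2 * k)) hsY (Equiv.refl ℤ) fun k => δ (2 * k)
  obtain ⟨E, hE⟩ : ∃ E : lp (fun k : ℤ => H (2 * k - 1)) 2 →L[ℂ] lp (fun k : ℤ => H (2 * k)) 2,
      ∀ y k, E y k = T k (y (σ k)) :=
    exists_lp_operator (G := fun k : ℤ => H (2 * k - 1)) hsX σ T
  have hAD : A = D + adjoint E := by
    ext x l
    obtain ⟨k, rfl⟩ := σ.surjective l
    rw [hA, add_apply, lp.coeFn_add, Pi.add_apply, hD, lp_adjoint_apply hE]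
    refine congrArg₂ _ rfl ?_
    rw [fcast_congr H (x := x) (show σ k - 1 = k from add_sub_cancel_right k 1) _
      (show 2 * k = 2 * σ k - 1 - 1 by change 2 * k = 2 * (k + 1) - 1 - 1; ring)]
    exact (adjoint_fcast_apply H δ _ _ _ _).symm
  have hBE : B = adjoint A := by
    rw [hAD, map_add, adjoint_adjoint, add_comm]
    ext y k
    rw [hB, add_apply, lp.coeFn_add, Pi.add_apply, hE]
    have hDk : adjoint D y k = adjoint (δ (2 * k)) (y k) :=
      lp_adjoint_apply (G := fun k : ℤ => H (2 * k)) (F := fun k : ℤ => H (2 * k - 1))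
      (T := fun k => δ (2 * k)) (σ := Equiv.refl ℤ) hD y k
    rw [hDk]
    rfl
  have hkD : ∀ x, x ∈ LinearMap.ker D.toLinearMap ↔
      ∀ k, x k ∈ LinearMap.ker (δ (2 * k)).toLinearMap :=
    mem_ker_lp (G := fun k : ℤ => H (2 * k)) (F := fun k : ℤ => H (2 * k - 1))
      (T := fun k => δ (2 * k)) (σ := Equiv.refl ℤ) hD
  have hrD : ∀ y, y ∈ LinearMap.range D.toLinearMap ↔ ∀ k, y k ∈ chainRange H δ (2 * k - 1) := by
    intro y
    simp only [mem_range_lp (G := fun k : ℤ => H (2 * k)) (F := fun k : ℤ => H (2 * k - 1))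
      (T := fun k => δ (2 * k)) (σ := Equiv.refl ℤ) hsX hD,
      ← range_eq_chainRange]
    rfl
  have hkE : ∀ y, y ∈ LinearMap.ker E.toLinearMap ↔
      ∀ k, y k ∈ LinearMap.ker (δ (2 * k - 1)).toLinearMap := by
    intro y
    rw [mem_ker_lp hE,
      ← σ.forall_congr_right (q := fun k => y k ∈ LinearMap.ker (δ (2 * k - 1)).toLinearMap)]
    exact forall_congr' fun k => mem_ker_fcast H δ _ _ _
  have hrE : ∀ x, x ∈ LinearMap.range E.toLinearMap ↔ ∀ k, x k ∈ chainRange H δ (2 * k) := by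
    intro x
    rw [mem_range_lp hsY hE]
    exact forall_congr' fun k => by rw [← range_fcast_eq_chainRange H δ
      (show 2 * (k + 1) - 1 = 2 * k + 1 by ring) (add_sub_cancel_right _ _)]; rfl
  have hfin := fun p => finiteDimensional_relQuot_chainRange H δ (hcomp p)
  have : FiniteDimensional ℂ
      (relQuot (LinearMap.range D.toLinearMap) (LinearMap.ker E.toLinearMap)) :=
    (finiteDimensional_relQuot_lp_iff hsY hrD hkE).2 fun _ => hfin _
  have : FiniteDimensional ℂ
      (relQuot (LinearMap.range E.toLinearMap) (LinearMap.ker D.toLinearMap)) :=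
    (finiteDimensional_relQuot_lp_iff hsX hrE hkD).2 fun _ => hfin _
  have hpair : IsFredholmChain H δ ↔ IsFredholmPair D E := by
    rw [isFredholmChain_iff_even_odd, IsFredholmPair,
      finiteDimensional_relQuot_lp_iff hsX hkD hrE, finiteDimensional_relQuot_lp_iff hsX hrE hkD,
      finiteDimensional_relQuot_lp_iff hsY hkE hrD, finiteDimensional_relQuot_lp_iff hsY hrD hkE,
      forall_and, forall_and, and_assoc]
  have hindex : IsFredholmPair D E → chainIndex H δ n = pairIndex D E := by
    rintro ⟨h₁, h₂, h₃, h₄⟩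
    rw [pairIndex, finrank_relQuot_lp hsX hkD hrE h₁, finrank_relQuot_lp hsX hrE hkD h₂,
      finrank_relQuot_lp hsY hkE hrD h₃, finrank_relQuot_lp hsY hrD hkE h₄, chainIndex,
      sum_range_neg_one_pow_mul fun p : ℤ =>
        (finrank ℂ (relQuot (LinearMap.ker (δ p).toLinearMap) (chainRange H δ p)) : ℤ) -
          finrank ℂ (relQuot (chainRange H δ p) (LinearMap.ker (δ p).toLinearMap))]
    · push_cast
      rw [Finset.sum_sub_distrib, Finset.sum_sub_distrib, sub_sub_eq_add_sub, add_sub_right_comm]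
    · intro p hp
      have := hzero p hp
      rw [finrank_zero_of_subsingleton, finrank_zero_of_subsingleton, sub_self]
  have hiA : IsFredholmChain H δ ↔ IsFredholmOp A := by
    rw [hpair, hAD, isFredholmPair_iff_isFredholmOp]
  have hAB : IsFredholmOp A ↔ IsFredholmOp B := by
    rw [hBE]
    refine ⟨fun h => h.hasIndex_adjoint.isFredholmOp, fun h => ?_⟩
    simpa only [adjoint_adjoint] using h.hasIndex_adjoint.isFredholmOp
  refine ⟨?_, fun h => ⟨?_, ?_⟩⟩
  · tfae_have 1 ↔ 2 := hiA
    tfae_have 2 ↔ 3 := hAB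
    tfae_finish
  · rw [hindex (hpair.1 h), hAD]
    exact (hpair.1 h).hasIndex.2.2.symm
  · have hB' : opIndex B = -opIndex A := hBE ▸ (hiA.1 h).hasIndex_adjoint.2.2
    rw [hB', neg_neg]
end
end

section
/- Let (H,δ) be a chain of Hilbert spaces H_p and bounded operators δ_p ∈ L(H_p,H_{p−1}), p ∈ ℤ, with H_p = 0 and δ_p = 0 for p < 0 and p ≥ n+1, where n is the first natural number with this property. Let (H′,δ′) be its dual chain, given by H′_p = H_{n−p} and δ′_p = δ*_{n−p+1}. Then (H,δ) is a Fredholm chain if and only if (H′,δ′) is a Fredholm chain, and in this case ind(H,δ) = (−1)ⁿ ind(H′,δ′). -/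
open Module ContinuousLinearMap

noncomputable section

set_option maxHeartbeats 1000000
set_option synthInstance.maxHeartbeats 1000000

theorem exists_finiteDimensional_isCompl_of_relQuot {E : Type*} [AddCommGroup E] [Module ℂ E]
    (p q : Submodule ℂ E)
    [FiniteDimensional ℂ (relQuot p q)] :
    ∃ G : Submodule ℂ p, FiniteDimensional ℂ G ∧ IsCompl ((p ⊓ q).comap p.subtype) G := by
  obtain ⟨G, hG⟩ := Submodule.exists_isCompl ((p ⊓ q).comap p.subtype)
  exact ⟨G, (Submodule.quotientEquivOfIsCompl _ _ hG).finiteDimensional, hG⟩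

section Hilbert

variable {E F : Type*} [NormedAddCommGroup E] [InnerProductSpace ℂ E] [CompleteSpace E]
  [NormedAddCommGroup F] [InnerProductSpace ℂ F] [CompleteSpace F]

/-- One half of the closed range theorem for operators between Hilbert spaces. -/
theorem range_adjoint_of_isClosed_range (T : E →L[ℂ] F)
    (hT : IsClosed (LinearMap.range T.toLinearMap : Set F)) :
    LinearMap.range (adjoint T).toLinearMap = (LinearMap.ker T.toLinearMap)ᗮ := by
  refine le_antisymm ?_ fun x hx => ?_
  · rw [ContinuousLinearMap.orthogonal_ker]
    exact Submodule.le_topologicalClosure _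
  set K := LinearMap.ker T.toLinearMap
  set R := LinearMap.range T.toLinearMap
  have hK : IsClosed (K : Set E) := T.isClosed_ker
  have := hK.completeSpace_coe
  have := hT.completeSpace_coe
  let f : Kᗮ →L[ℂ] R := (T ∘L Kᗮ.subtypeL).codRestrict R fun u => ⟨u, rfl⟩
  have hinj : f.ker = ⊥ := by
    refine (Submodule.eq_bot_iff _).2 fun u hu => ?_
    have huK : (u : E) ∈ K := congrArg Subtype.val hu
    exact Subtype.ext (inner_self_eq_zero.1 (u.2 _ huK))
  have hproj (u : E) : T (Kᗮ.orthogonalProjectionOnto u) = T u := by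
    have h : u - Kᗮ.orthogonalProjectionOnto u ∈ Kᗮᗮ :=
      Submodule.sub_starProjection_mem_orthogonal u
    rw [Submodule.orthogonal_orthogonal] at h
    have h' : T (u - Kᗮ.orthogonalProjectionOnto u) = 0 := h
    rw [map_sub, sub_eq_zero] at h'
    exact h'.symm
  have hsurj : f.range = ⊤ := by
    refine (Submodule.eq_top_iff').2 ?_
    rintro ⟨_, u, rfl⟩
    exact ⟨Kᗮ.orthogonalProjectionOnto u, Subtype.ext (hproj u)⟩
  let e := ContinuousLinearEquiv.ofBijective f hinj hsurj
  refine ⟨(adjoint (e.symm : R →L[ℂ] Kᗮ) ⟨x, hx⟩ : R), ?_⟩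
  refine ext_inner_right ℂ fun u => ?_
  have heu : e.symm ⟨T u, u, rfl⟩ = Kᗮ.orthogonalProjectionOnto u := by
    rw [ContinuousLinearEquiv.symm_apply_eq]
    exact Subtype.ext (hproj u).symm
  calc inner ℂ (adjoint T (adjoint (e.symm : R →L[ℂ] Kᗮ) ⟨x, hx⟩ : R)) u
      = inner ℂ (adjoint (e.symm : R →L[ℂ] Kᗮ) ⟨x, hx⟩) (⟨T u, u, rfl⟩ : R) := by
        rw [adjoint_inner_left]; rfl
    _ = inner ℂ (⟨x, hx⟩ : Kᗮ) (Kᗮ.orthogonalProjectionOnto u) := by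
        rw [adjoint_inner_left, ← heu]; rfl
    _ = inner ℂ x u := Submodule.inner_orthogonalProjectionOnto_eq_of_mem_left _ _

theorem isClosed_range_adjoint_iff (T : E →L[ℂ] F) :
    IsClosed (LinearMap.range (adjoint T).toLinearMap : Set E) ↔
      IsClosed (LinearMap.range T.toLinearMap : Set F) := by
  refine ⟨fun h => ?_, fun hT => ?_⟩
  · rw [← adjoint_adjoint T, range_adjoint_of_isClosed_range _ h]
    exact Submodule.isClosed_orthogonal _
  · rw [range_adjoint_of_isClosed_range T hT]
    exact Submodule.isClosed_orthogonal _

/-- If the range of `A` meets a closed subspace `M` in finite codimension on both sides, then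
it is closed. -/
theorem isClosed_range_of_finiteDimensional_relQuot_s16 (A : E →L[ℂ] F) (M : Submodule ℂ F)
    (hM : IsClosed (M : Set F))
    (h₁ : FiniteDimensional ℂ (relQuot M (LinearMap.range A.toLinearMap)))
    (h₂ : FiniteDimensional ℂ (relQuot (LinearMap.range A.toLinearMap) M)) :
    IsClosed (LinearMap.range A.toLinearMap : Set F) := by
  set R := LinearMap.range A.toLinearMap
  set K := LinearMap.ker A.toLinearMap
  have hK : IsClosed (K : Set E) := A.isClosed_ker
  have := hK.completeSpace_coe
  have := hM.completeSpace_coe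
  let W : Submodule ℂ E := M.comap A.toLinearMap ⊓ Kᗮ
  have hW : IsClosed (W : Set E) :=
    (hM.preimage A.continuous).inter (Submodule.isClosed_orthogonal K)
  have := hW.completeSpace_coe
  let f : W →L[ℂ] M := (A ∘L W.subtypeL).codRestrict M fun w => w.2.1
  have hker : f.ker = ⊥ := by
    refine (Submodule.eq_bot_iff _).2 fun u hu => ?_
    have huK : (u : E) ∈ K := congrArg Subtype.val hu
    exact Subtype.ext (inner_self_eq_zero.1 (u.2.2 _ huK))
  have hrange : f.range = (M ⊓ R).comap M.subtype := by
    ext y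
    constructor
    · rintro ⟨w, rfl⟩
      exact ⟨(f w).2, w, rfl⟩
    · rintro ⟨hy, u, hu⟩
      have hp : A (u - K.orthogonalProjectionOnto u) = y := by
        rw [map_sub, show A (K.orthogonalProjectionOnto u) = 0 from
          (K.orthogonalProjectionOnto u).2, sub_zero]
        exact hu
      refine ⟨⟨u - K.orthogonalProjectionOnto u, ?_,
        Submodule.sub_starProjection_mem_orthogonal u⟩, Subtype.ext hp⟩
      change A (u - K.orthogonalProjectionOnto u) ∈ M
      rw [hp]
      exact y.2
  obtain ⟨G, hGfin, hG⟩ := exists_finiteDimensional_isCompl_of_relQuot M R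
  have hf : IsClosed (f.range : Set M) :=
    f.closed_complemented_range_of_isCompl_of_ker_eq_bot G (hrange ▸ hG)
      G.closed_of_finiteDimensional hker
  have hMR : IsClosed ((M ⊓ R : Submodule ℂ F) : Set F) := by
    have h := hM.isClosedEmbedding_subtypeVal.isClosedMap _ hf
    rw [hrange] at h
    convert h
    ext y
    exact ⟨fun hy => ⟨⟨y, hy.1⟩, hy, rfl⟩, by rintro ⟨z, hz, rfl⟩; exact hz⟩
  obtain ⟨G', hG'fin, hG'⟩ := exists_finiteDimensional_isCompl_of_relQuot R M
  have hR : R = (M ⊓ R) ⊔ G'.map R.subtype := by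
    have h := congrArg (Submodule.map R.subtype) hG'.sup_eq_top
    rw [Submodule.map_sup, Submodule.map_top, Submodule.range_subtype,
      Submodule.map_comap_subtype, ← inf_assoc, inf_idem, inf_comm] at h
    exact h.symm
  rw [hR]
  exact Submodule.isClosed_sup_finiteDimensional _ _ hMR

/-- Passing to orthogonal complements preserves the dimension of `M / (M ⊓ L)`, in the form of
`Lᗮ / (Lᗮ ⊓ Mᗮ)`. -/
theorem relQuot_orthogonal_of_finiteDimensional (M L : Submodule ℂ E)
    (hL : IsClosed (L : Set E)) (h : FiniteDimensional ℂ (relQuot M L)) :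
    FiniteDimensional ℂ (relQuot Lᗮ Mᗮ) ∧
      finrank ℂ (relQuot Lᗮ Mᗮ) = finrank ℂ (relQuot M L) := by
  have := hL.completeSpace_coe
  let g : M →ₗ[ℂ] Lᗮ := Lᗮ.orthogonalProjectionOnto.toLinearMap ∘ₗ M.subtype
  have hg : LinearMap.ker g = (M ⊓ L).comap M.subtype := by
    ext m
    change Lᗮ.orthogonalProjectionOnto (m : E) = 0 ↔ (m : E) ∈ M ⊓ L
    rw [Submodule.orthogonalProjectionOnto_eq_zero_iff, Submodule.orthogonal_orthogonal]
    simp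
  let e₁ : relQuot M L ≃ₗ[ℂ] LinearMap.range g :=
    (Submodule.quotEquivOfEq _ _ hg.symm).trans g.quotKerEquivRange
  have : FiniteDimensional ℂ (LinearMap.range g) := e₁.finiteDimensional
  let P : Lᗮ →L[ℂ] LinearMap.range g := (LinearMap.range g).orthogonalProjectionOnto
  have hP : LinearMap.ker P.toLinearMap = (Lᗮ ⊓ Mᗮ).comap Lᗮ.subtype := by
    ext x
    change P x = 0 ↔ (x : E) ∈ Lᗮ ∧ (x : E) ∈ Mᗮ
    rw [Submodule.orthogonalProjectionOnto_eq_zero_iff]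
    have key (m : M) : inner ℂ (g m) x = inner ℂ (m : E) (x : E) :=
      Submodule.inner_orthogonalProjectionOnto_eq_of_mem_right x (m : E)
    constructor
    · exact fun hx => ⟨x.2, fun m hm => (key ⟨m, hm⟩).symm.trans (hx _ ⟨⟨m, hm⟩, rfl⟩)⟩
    · rintro hx _ ⟨m, rfl⟩
      exact (key m).trans (hx.2 m m.2)
  have hPr : LinearMap.range P.toLinearMap = ⊤ := by
    refine (Submodule.eq_top_iff').2 fun y => ⟨y, ?_⟩
    exact Submodule.orthogonalProjectionOnto_mem_subspace_eq_self y
  let e₂ : relQuot Lᗮ Mᗮ ≃ₗ[ℂ] LinearMap.range g :=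
    (Submodule.quotEquivOfEq _ _ hP.symm).trans
      (P.toLinearMap.quotKerEquivOfSurjective (LinearMap.range_eq_top.1 hPr))
  exact ⟨e₂.symm.finiteDimensional, (e₂.trans e₁.symm).finrank_eq⟩

theorem finiteDimensional_relQuot_orthogonal_iff (M L : Submodule ℂ E)
    (hM : IsClosed (M : Set E)) (hL : IsClosed (L : Set E)) :
    FiniteDimensional ℂ (relQuot Lᗮ Mᗮ) ↔ FiniteDimensional ℂ (relQuot M L) := by
  refine ⟨fun h => ?_, fun h => (relQuot_orthogonal_of_finiteDimensional M L hL h).1⟩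
  have := hM.completeSpace_coe
  have := hL.completeSpace_coe
  have h' := (relQuot_orthogonal_of_finiteDimensional Lᗮ Mᗮ (Submodule.isClosed_orthogonal M) h).1
  rwa [Submodule.orthogonal_orthogonal, Submodule.orthogonal_orthogonal] at h'

end Hilbert

section Chain

theorem isClosed_chainRange (H : ℤ → Type*) [∀ p, NormedAddCommGroup (H p)]
    [∀ p, InnerProductSpace ℂ (H p)] [∀ p, CompleteSpace (H p)]
    (δ : ∀ p : ℤ, H p →L[ℂ] H (p - 1)) (h : IsFredholmChain H δ) (p : ℤ) :
    IsClosed (chainRange H δ p : Set (H p)) := by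
  have hr : chainRange H δ p = LinearMap.range
      (fcastL H (show p + 1 - 1 = p by ring) ∘L δ (p + 1)).toLinearMap :=
    (LinearMap.range_comp _ _).symm
  have hp := h p
  rw [hr] at hp ⊢
  exact isClosed_range_of_finiteDimensional_relQuot_s16 _ _ (δ p).isClosed_ker hp.1 hp.2

variable (H : ℤ → Type*) [∀ p, NormedAddCommGroup (H p)] [∀ p, InnerProductSpace ℂ (H p)]

theorem inner_fcastL_left {p q : ℤ} (h : p = q) (x : H p) (y : H q) :
    inner ℂ (fcastL H h x) y = inner ℂ x (fcastL H h.symm y) := by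
  subst h; rfl

theorem isClosed_map_fcastL_iff {p q : ℤ} (h : p = q) (S : Submodule ℂ (H p)) :
    IsClosed (S.map (fcastL H h).toLinearMap : Set (H q)) ↔ IsClosed (S : Set (H p)) := by
  subst h
  rw [show (fcastL H rfl).toLinearMap = (LinearMap.id : H p →ₗ[ℂ] H p) from rfl, Submodule.map_id]

variable [∀ p, CompleteSpace (H p)] {n : ℤ} {δ : ∀ p : ℤ, H p →L[ℂ] H (p - 1)}
  {δ' : ∀ p : ℤ, H (n - p) →L[ℂ] H (n - (p - 1))}

theorem ker_dual
    (hδ' : ∀ p : ℤ, δ' p =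
      fcastL H (show n - p + 1 = n - (p - 1) by ring) ∘L
        (adjoint (δ (n - p + 1)) ∘L
          fcastL H (show n - p = n - p + 1 - 1 by ring))) (q : ℤ) :
    LinearMap.ker (δ' q).toLinearMap = (chainRange H δ (n - q))ᗮ := by
  ext x
  have hx : x ∈ LinearMap.ker (δ' q).toLinearMap ↔ fcastL H (show n - q = n - q + 1 - 1 by ring) x ∈
      LinearMap.ker (adjoint (δ (n - q + 1))).toLinearMap := by
    rw [LinearMap.mem_ker, LinearMap.mem_ker, hδ']
    exact (fcast H _).map_eq_zero_iff
  rw [hx, ← ContinuousLinearMap.orthogonal_range]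
  constructor
  · rintro h _ ⟨y, hy, rfl⟩
    exact (inner_fcastL_left H _ _ _).trans (h y hy)
  · intro h y hy
    exact (inner_fcastL_left H _ _ _).symm.trans (h _ ⟨y, hy, rfl⟩)

theorem chainRange_dual
    (hδ' : ∀ p : ℤ, δ' p =
      fcastL H (show n - p + 1 = n - (p - 1) by ring) ∘L
        (adjoint (δ (n - p + 1)) ∘L
          fcastL H (show n - p = n - p + 1 - 1 by ring))) (q : ℤ) :
    chainRange (fun p => H (n - p)) δ' q =
      LinearMap.range (adjoint (δ (n - q))).toLinearMap := by
  have cast_eq : ∀ {a b : ℤ} (h : a = b) (h' : n - a = n - b) (x : H (n - a)),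
      fcastL (fun p => H (n - p)) h x = fcastL H h' x := by
    rintro a b rfl h' x; rfl
  have aux : ∀ {a b s t : ℤ} (hab : a = b) (hs : s = a - 1) (hat : a = t) (htb : t = b),
      (LinearMap.range (fcastL H hat ∘L (adjoint (δ a) ∘L fcastL H hs)).toLinearMap).map
        (fcastL H htb).toLinearMap = LinearMap.range (adjoint (δ b)).toLinearMap := by
    rintro a b s t rfl rfl rfl htb
    exact Submodule.map_id _
  rw [chainRange, hδ', ← aux (show n - (q + 1) + 1 = n - q by ring)
    (show n - (q + 1) = n - (q + 1) + 1 - 1 by ring)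
    (show n - (q + 1) + 1 = n - (q + 1 - 1) by ring) (show n - (q + 1 - 1) = n - q by ring)]
  congr 1
  ext x
  exact cast_eq _ _ x

end Chain

theorem fredholm_chain_dual (H : ℤ → Type) [∀ p, NormedAddCommGroup (H p)]
    [∀ p, InnerProductSpace ℂ (H p)] [∀ p, CompleteSpace (H p)] (n : ℕ)
    (hzero : ∀ p : ℤ, (p < 0 ∨ (n : ℤ) + 1 ≤ p) → Subsingleton (H p))
    (hmin : ∀ m : ℕ, (∀ p : ℤ, (p < 0 ∨ (m : ℤ) + 1 ≤ p) → Subsingleton (H p)) → n ≤ m)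
    (δ : ∀ p : ℤ, H p →L[ℂ] H (p - 1))
    (δ' : ∀ p : ℤ, H ((n : ℤ) - p) →L[ℂ] H ((n : ℤ) - (p - 1)))
    (hδ' : ∀ p : ℤ, δ' p =
      fcastL H (show (n : ℤ) - p + 1 = (n : ℤ) - (p - 1) by ring) ∘L
        (adjoint (δ ((n : ℤ) - p + 1)) ∘L
          fcastL H (show (n : ℤ) - p = (n : ℤ) - p + 1 - 1 by ring))) :
    (IsFredholmChain H δ ↔ IsFredholmChain (fun p => H ((n : ℤ) - p)) δ') ∧
    (IsFredholmChain H δ →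
      chainIndex H δ n = (-1 : ℤ) ^ n * chainIndex (fun p => H ((n : ℤ) - p)) δ' n) := by
  have hker := ker_dual H hδ'
  have hran := chainRange_dual H hδ'
  have hkc (p : ℤ) : IsClosed (LinearMap.ker (δ p).toLinearMap : Set (H p)) := (δ p).isClosed_ker
  have closed_iff (p : ℤ) : IsClosed (chainRange H δ p : Set (H p)) ↔
      IsClosed (LinearMap.range (δ (p + 1)).toLinearMap : Set (H (p + 1 - 1))) :=
    isClosed_map_fcastL_iff H _ _
  have range_eq (hR : ∀ p, IsClosed (chainRange H δ p : Set (H p))) (q : ℤ) :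
      chainRange (fun p => H ((n : ℤ) - p)) δ' q = (LinearMap.ker (δ ((n : ℤ) - q)).toLinearMap)ᗮ := by
    rw [hran q]
    refine range_adjoint_of_isClosed_range _ ?_
    obtain ⟨r, hr⟩ : ∃ r, r + 1 = (n : ℤ) - q := ⟨n - q - 1, by ring⟩
    rw [← hr]
    exact (closed_iff r).1 (hR r)
  have closed_dual (h : IsFredholmChain (fun p => H ((n : ℤ) - p)) δ') (p : ℤ) :
      IsClosed (chainRange H δ p : Set (H p)) := by
    rw [closed_iff, ← isClosed_range_adjoint_iff]
    obtain ⟨q, hq⟩ : ∃ q, (n : ℤ) - q = p + 1 := ⟨n - p - 1, by ring⟩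
    have hc := isClosed_chainRange _ δ' h q
    rw [hran q] at hc
    rwa [hq] at hc
  have fred_iff (hR : ∀ p, IsClosed (chainRange H δ p : Set (H p))) :
      IsFredholmChain H δ ↔ IsFredholmChain (fun p => H ((n : ℤ) - p)) δ' := by
    rw [IsFredholmChain, IsFredholmChain, ← (Equiv.subLeft (n : ℤ)).forall_congr_right]
    refine forall_congr' fun q => ?_
    rw [hker q, range_eq hR q]
    exact and_congr (finiteDimensional_relQuot_orthogonal_iff _ _ (hkc _) (hR _)).symm
      (finiteDimensional_relQuot_orthogonal_iff _ _ (hR _) (hkc _)).symm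
  refine ⟨⟨fun h => (fred_iff (isClosed_chainRange H δ h)).1 h,
    fun h => (fred_iff (closed_dual h)).2 h⟩, fun h => ?_⟩
  have hR := isClosed_chainRange H δ h
  rw [chainIndex, chainIndex, ← Finset.sum_range_reflect, Finset.mul_sum]
  refine Finset.sum_congr rfl fun j hj => ?_
  have hjn : j ≤ n := Nat.lt_succ_iff.1 (Finset.mem_range.1 hj)
  rw [hker j, range_eq hR j,
    (relQuot_orthogonal_of_finiteDimensional _ _ (hR _) (h ((n : ℤ) - j)).1).2,
    (relQuot_orthogonal_of_finiteDimensional _ _ (hkc _) (h ((n : ℤ) - j)).2).2,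
    show n + 1 - 1 - j = n - j by omega, Nat.cast_sub hjn, ← mul_assoc]
  congr 1
  obtain ⟨k, rfl⟩ := Nat.exists_eq_add_of_le hjn
  rw [Nat.add_sub_cancel_left, pow_add, mul_right_comm, ← mul_pow]
  simp
end
end

section
/- Let (H,δ) be a Fredholm chain of Hilbert spaces H_p and bounded operators δ_p ∈ L(H_p,H_{p−1}), p ∈ ℤ, with H_p = 0 and δ_p = 0 for p < 0 and p ≥ n+1. Then there exists ε > 0 such that for every chain (H,δ′) on the same spaces with R(δ′_pδ′_{p+1}) finite-dimensional for each p ∈ ℤ, if ‖δ_p − δ′_p‖ < ε for all p ∈ ℤ, then (H,δ′) is a Fredholm chain and ind(H,δ) = ind(H,δ′). -/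
open Module ContinuousLinearMap

noncomputable section

set_option maxHeartbeats 1000000
set_option synthInstance.maxHeartbeats 1000000

lemma enat_add_ne_top {x y : ℕ∞} : x + y ≠ ⊤ ↔ x ≠ ⊤ ∧ y ≠ ⊤ :=
  ENat.add_eq_top.not.trans not_or

section RelativeDimension

variable {E E' : Type*} [AddCommGroup E] [Module ℂ E] [AddCommGroup E'] [Module ℂ E']

/-- The dimension of `p / (p ⊓ q)` as an extended natural number. -/
def relDim (p q : Submodule ℂ E) : ℕ∞ := Module.length ℂ (relQuot p q)

lemma length_eq_map_add_inf_ker (f : E →ₗ[ℂ] E') (p : Submodule ℂ E) :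
    Module.length ℂ p =
      Module.length ℂ (p.map f) + Module.length ℂ ↥(p ⊓ LinearMap.ker f) := by
  have h := Module.length_eq_add_of_exact (LinearMap.ker (f.domRestrict p)).subtype
    (f.domRestrict p).rangeRestrict (Submodule.subtype_injective _)
    (LinearMap.surjective_rangeRestrict _) (by
      intro x
      simp [Subtype.ext_iff])
  rw [h, add_comm, LinearMap.range_domRestrict, LinearMap.ker_domRestrict]
  congr 1
  have e : (LinearMap.ker f).comap p.subtype = (p ⊓ LinearMap.ker f).comap p.subtype := by
    ext x; simp
  rw [e]
  exact (Submodule.comapSubtypeEquivOfLe inf_le_left).length_eq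

lemma relDim_ker (f : E →ₗ[ℂ] E') (p : Submodule ℂ E) :
    relDim p (LinearMap.ker f) = Module.length ℂ (p.map f) := by
  have e : (p ⊓ LinearMap.ker f).comap p.subtype = LinearMap.ker (f.domRestrict p) := by
    ext x; simp
  rw [relDim, (Submodule.quotEquivOfEq _ _ e).length_eq,
    (f.domRestrict p).quotKerEquivRange.length_eq, LinearMap.range_domRestrict]

lemma relDim_eq (p q : Submodule ℂ E) :
    relDim p q = Module.length ℂ (p.map q.mkQ) := by
  rw [← relDim_ker, Submodule.ker_mkQ]

lemma relDim_inf_right (p q : Submodule ℂ E) : relDim p (p ⊓ q) = relDim p q :=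
  (Submodule.quotEquivOfEq _ _ (by rw [← inf_assoc, inf_idem])).length_eq

lemma relDim_sup_left (p q : Submodule ℂ E) : relDim (p ⊔ q) q = relDim p q := by
  rw [relDim_eq, relDim_eq, Submodule.map_sup, Submodule.mkQ_map_self, sup_bot_eq]

lemma relDim_mono_left {p p' : Submodule ℂ E} (h : p ≤ p') (q : Submodule ℂ E) :
    relDim p q ≤ relDim p' q := by
  rw [relDim_eq, relDim_eq]
  exact Module.length_le_of_injective (Submodule.inclusion (Submodule.map_mono h))
    (Submodule.inclusion_injective _)

lemma relDim_trans {p q r : Submodule ℂ E} (hrq : r ≤ q) (hqp : q ≤ p) :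
    relDim p r = relDim p q + relDim q r := by
  rw [relDim_eq, relDim_eq, relDim_eq, length_eq_map_add_inf_ker (Submodule.factor hrq)]
  have : LinearMap.ker (Submodule.factor hrq) = q.map r.mkQ := by
    rw [Submodule.factor, Submodule.ker_mapQ, Submodule.comap_id]
  rw [this, inf_eq_right.2 (Submodule.map_mono hqp), ← Submodule.map_comp,
    Submodule.factor_comp_mk]

lemma relDim_map (f : E →ₗ[ℂ] E') (p q : Submodule ℂ E) :
    relDim (p.map f) (q.map f) = relDim p (q ⊔ LinearMap.ker f) := by
  rw [relDim_eq, ← Submodule.map_comp, ← relDim_ker, LinearMap.ker_comp, Submodule.ker_mkQ,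
    Submodule.comap_map_eq]

lemma relDim_bot_left (q : Submodule ℂ E) : relDim ⊥ q = 0 := by
  rw [relDim_eq, Submodule.map_bot, Module.length_bot]

lemma relDim_top_left (q : Submodule ℂ E) : relDim ⊤ q = Module.length ℂ (E ⧸ q) := by
  rw [relDim_eq, Submodule.map_top, Submodule.range_mkQ, Module.length_top]

lemma relDim_sup_sup {p q w : Submodule ℂ E} (h : q ≤ p) (hw : p ⊓ w = ⊥) :
    relDim (p ⊔ w) (q ⊔ w) = relDim p q := by
  have e : p ⊔ w = p ⊔ (q ⊔ w) := by rw [← sup_assoc, sup_eq_left.2 h]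
  rw [e, relDim_sup_left, ← relDim_inf_right, inf_comm, sup_inf_assoc_of_le _ h, inf_comm w, hw,
    sup_bot_eq]

lemma finite_of_length_ne_top (h : Module.length ℂ E ≠ ⊤) : FiniteDimensional ℂ E :=
  haveI := (isFiniteLength_iff_isNoetherian_isArtinian.1 (Module.length_ne_top_iff.1 h)).1
  inferInstance

lemma length_ne_top_of_finite (h : FiniteDimensional ℂ E) : Module.length ℂ E ≠ ⊤ :=
  Module.length_ne_top

lemma finite_relQuot_iff {p q : Submodule ℂ E} :
    FiniteDimensional ℂ (relQuot p q) ↔ relDim p q ≠ ⊤ :=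
  ⟨length_ne_top_of_finite, finite_of_length_ne_top⟩

lemma coe_finrank_relQuot {p q : Submodule ℂ E} (h : relDim p q ≠ ⊤) :
    (finrank ℂ (relQuot p q) : ℕ∞) = relDim p q :=
  haveI := finite_relQuot_iff.2 h
  (Module.length_eq_finrank ..).symm

variable (a : E →ₗ[ℂ] E') {R V W : Submodule ℂ E}

lemma relDim_top_add_eq (hVW : V ⊓ W = ⊥) (hW : LinearMap.ker a ⊓ W = ⊥) :
    relDim ⊤ (V ⊔ W) + relDim V (LinearMap.ker a) =
      relDim (LinearMap.range a) (W.map a) + relDim (LinearMap.ker a) V := by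
  have hr : relDim (LinearMap.range a) (W.map a) = relDim ⊤ (LinearMap.ker a ⊔ W) := by
    rw [← Submodule.map_top, relDim_map, sup_comm]
  rw [hr, ← relDim_inf_right V, ← relDim_inf_right _ V, inf_comm V,
    ← relDim_sup_sup inf_le_right hVW, ← relDim_sup_sup inf_le_left hW,
    ← relDim_trans (sup_le_sup_right inf_le_right _) le_top,
    ← relDim_trans (sup_le_sup_right inf_le_left _) le_top]

lemma relDim_range_map_ne_top (hVW : V ⊓ W = ⊥) (hW : LinearMap.ker a ⊓ W = ⊥)
    (hf : relDim ⊤ (V ⊔ W) ≠ ⊤) (hV : relDim V (LinearMap.ker a) ≠ ⊤) :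
    relDim (LinearMap.range a) (W.map a) ≠ ⊤ := fun h =>
  enat_add_ne_top.2 ⟨hf, hV⟩ (by rw [relDim_top_add_eq a hVW hW, h, top_add])

/-- The local index formula: comparison of the kernel of `a` with a subspace `R` that `a` maps to
a finite-dimensional space. -/
lemma relDim_ker_sub_relDim (hVR : V ≤ R) (hVW : V ⊓ W = ⊥) (hW : LinearMap.ker a ⊓ W = ⊥)
    (hf : relDim ⊤ (V ⊔ W) ≠ ⊤) (hR : relDim R (LinearMap.ker a) ≠ ⊤) (hRV : relDim R V ≠ ⊤) :
    relDim (LinearMap.ker a) R ≠ ⊤ ∧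
      ((relDim (LinearMap.ker a) R).toNat : ℤ) - (relDim R (LinearMap.ker a)).toNat =
        (relDim ⊤ (V ⊔ W)).toNat - (relDim (LinearMap.range a) (W.map a)).toNat
          - (relDim R V).toNat := by
  have hV := ne_top_of_le_ne_top hR (relDim_mono_left hVR (LinearMap.ker a))
  have hr := relDim_range_map_ne_top a hVW hW hf hV
  have e₁ := relDim_top_add_eq a hVW hW
  have hNV : relDim (LinearMap.ker a) V ≠ ⊤ :=
    (enat_add_ne_top.1 (e₁ ▸ enat_add_ne_top.2 ⟨hf, hV⟩)).2
  have e₂ : relDim (LinearMap.ker a) V =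
      relDim (LinearMap.ker a) R + relDim (LinearMap.ker a ⊓ R) (LinearMap.ker a ⊓ V) := by
    rw [← relDim_inf_right _ V, ← relDim_inf_right _ R]
    exact relDim_trans (inf_le_inf_left _ hVR) inf_le_left
  have e₃ : relDim R V + relDim V (LinearMap.ker a) =
      relDim R (LinearMap.ker a) + relDim (LinearMap.ker a ⊓ R) (LinearMap.ker a ⊓ V) := by
    rw [← relDim_inf_right V, ← relDim_inf_right R (LinearMap.ker a), inf_comm V, inf_comm R,
      ← relDim_trans inf_le_right hVR, ← relDim_trans (inf_le_inf_left _ hVR) inf_le_right]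
  have hx := enat_add_ne_top.1 (e₂ ▸ hNV)
  refine ⟨hx.1, ?_⟩
  generalize relDim (LinearMap.ker a ⊓ R) (LinearMap.ker a ⊓ V) = x at *
  generalize relDim (LinearMap.ker a) R = y₁ at *
  generalize relDim (LinearMap.ker a) V = y₂ at *
  generalize relDim R (LinearMap.ker a) = y₃ at *
  generalize relDim R V = y₄ at *
  generalize relDim V (LinearMap.ker a) = y₅ at *
  generalize relDim ⊤ (V ⊔ W) = y₆ at *
  generalize relDim (LinearMap.range a) (W.map a) = y₇ at *
  lift x to ℕ using hx.2
  lift y₁ to ℕ using hx.1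
  lift y₂ to ℕ using hNV
  lift y₃ to ℕ using hR
  lift y₄ to ℕ using hRV
  lift y₅ to ℕ using hV
  lift y₆ to ℕ using hf
  lift y₇ to ℕ using hr
  norm_cast at e₁ e₂ e₃
  simp only [ENat.toNat_natCast]
  lia

end RelativeDimension

section Decomposition

variable {X Y Z : Type*} [NormedAddCommGroup X] [InnerProductSpace ℂ X]
  [NormedAddCommGroup Y] [InnerProductSpace ℂ Y]
  [NormedAddCommGroup Z] [InnerProductSpace ℂ Z]

/-- The addition map `U × W × F → Y`, `(u, w, f) ↦ b u + w + f`. -/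
def additionMap (U : Submodule ℂ X) (W F : Submodule ℂ Y) (b : X →L[ℂ] Y) : (U × W × F) →L[ℂ] Y :=
  (b ∘L U.subtypeL).coprod (W.subtypeL.coprod F.subtypeL)

lemma additionMap_apply (U : Submodule ℂ X) (W F : Submodule ℂ Y) (b : X →L[ℂ] Y) (x : U × W × F) :
    additionMap U W F b x = b x.1 + (x.2.1 + x.2.2) := rfl

lemma continuous_additionMap (U : Submodule ℂ X) (W F : Submodule ℂ Y) :
    Continuous (additionMap U W F) := by
  have h : additionMap U W F = fun b => (b ∘L U.subtypeL) ∘L ContinuousLinearMap.fst ℂ U (W × F)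
      + (W.subtypeL.coprod F.subtypeL) ∘L ContinuousLinearMap.snd ℂ U (W × F) := by
    ext b x <;> simp [additionMap]
  rw [h]
  fun_prop

lemma additionMap_bijective_iff {U : Submodule ℂ X} {W F : Submodule ℂ Y} {b : X →L[ℂ] Y} :
    Function.Bijective (additionMap U W F b) ↔
      LinearMap.ker b.toLinearMap ⊓ U = ⊥ ∧ U.map b.toLinearMap ⊓ W = ⊥ ∧
        IsCompl (U.map b.toLinearMap ⊔ W) F := by
  constructor
  · rintro ⟨hi, hs⟩
    rw [injective_iff_map_eq_zero] at hi
    refine ⟨?_, ?_, ?_, ?_⟩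
    · refine (Submodule.eq_bot_iff _).2 fun x ⟨hx, hxU⟩ => ?_
      have := hi (⟨x, hxU⟩, 0, 0) (by simpa [additionMap_apply] using hx)
      simpa using congrArg Prod.fst this
    · refine (Submodule.eq_bot_iff _).2 ?_
      rintro _ ⟨⟨x, hx, rfl⟩, hxW⟩
      have := hi (⟨x, hx⟩, -⟨_, hxW⟩, 0) (by simp [additionMap_apply])
      simpa using congrArg (fun z => z.2.1) this
    · rw [Submodule.disjoint_def]
      intro y hy hyF
      obtain ⟨_, ⟨x, hx, rfl⟩, w, hw, rfl⟩ := Submodule.mem_sup.1 hy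
      have := hi (⟨x, hx⟩, ⟨w, hw⟩, -⟨_, hyF⟩) (by simp [additionMap_apply])
      simpa using congrArg (fun z => z.2.2) this
    · rw [codisjoint_iff, eq_top_iff]
      intro y _
      obtain ⟨⟨u, w, f⟩, rfl⟩ := hs y
      rw [additionMap_apply, ← add_assoc]
      exact Submodule.add_mem_sup (Submodule.add_mem_sup ⟨u, u.2, rfl⟩ w.2) f.2
  · rintro ⟨hU, hVW, hF⟩
    constructor
    · rw [injective_iff_map_eq_zero]
      rintro ⟨u, w, f⟩ h
      rw [additionMap_apply, ← add_assoc] at h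
      have hv : b u ∈ U.map b.toLinearMap := ⟨u, u.2, rfl⟩
      have hf : (f : Y) = 0 := by
        refine Submodule.disjoint_def.1 hF.disjoint _ ?_ f.2
        rw [← neg_mem_iff, ← eq_neg_of_add_eq_zero_left h]
        exact Submodule.add_mem_sup hv w.2
      simp only [hf, add_zero] at h
      have hw : (w : Y) = 0 := by
        refine (Submodule.eq_bot_iff _).1 hVW _ ⟨?_, w.2⟩
        rw [SetLike.mem_coe, ← neg_mem_iff, ← eq_neg_of_add_eq_zero_left h]
        exact hv
      simp only [hw, add_zero] at h
      have hu : (u : X) = 0 := (Submodule.eq_bot_iff _).1 hU _ ⟨h, u.2⟩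
      simp only [Submodule.coe_eq_zero] at hu hw hf
      rw [hu, hw, hf]; rfl
    · intro y
      have hy : y ∈ U.map b.toLinearMap ⊔ W ⊔ F := by rw [hF.sup_eq_top]; trivial
      obtain ⟨_, h, f, hf, rfl⟩ := Submodule.mem_sup.1 hy
      obtain ⟨_, ⟨x, hx, rfl⟩, w, hw, rfl⟩ := Submodule.mem_sup.1 h
      exact ⟨(⟨x, hx⟩, ⟨w, hw⟩, ⟨f, hf⟩), by rw [additionMap_apply, ← add_assoc]; rfl⟩

lemma exists_stable_decomposition [CompleteSpace X] [CompleteSpace Y] {b : X →L[ℂ] Y} {U : Submodule ℂ X} {W : Submodule ℂ Y}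
    (hUc : IsClosed (U : Set X)) (hWc : IsClosed (W : Set Y))
    (hU : LinearMap.ker b.toLinearMap ⊓ U = ⊥) (hVW : U.map b.toLinearMap ⊓ W = ⊥)
    (hf : relDim ⊤ (U.map b.toLinearMap ⊔ W) ≠ ⊤) :
    ∃ ε > (0 : ℝ), ∀ b' : X →L[ℂ] Y, ‖b - b'‖ < ε →
      LinearMap.ker b'.toLinearMap ⊓ U = ⊥ ∧ U.map b'.toLinearMap ⊓ W = ⊥ ∧
        relDim ⊤ (U.map b'.toLinearMap ⊔ W) = relDim ⊤ (U.map b.toLinearMap ⊔ W) := by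
  obtain ⟨F, hF⟩ := Submodule.exists_isCompl (U.map b.toLinearMap ⊔ W)
  rw [relDim_top_left] at hf ⊢
  have eF := (Submodule.quotientEquivOfIsCompl _ _ hF).length_eq
  rw [eF] at hf ⊢
  have := finite_of_length_ne_top hf
  have := hUc.completeSpace_coe
  have := hWc.completeSpace_coe
  have hb : Function.Bijective (additionMap U W F b) := additionMap_bijective_iff.2 ⟨hU, hVW, hF⟩
  have hnhds := (continuous_additionMap U W F).continuousAt.preimage_mem_nhds
    (ContinuousLinearEquiv.isOpen.mem_nhds
      ⟨ContinuousLinearEquiv.ofBijective (additionMap U W F b) (LinearMap.ker_eq_bot.2 hb.1)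
        (LinearMap.range_eq_top.2 hb.2), ContinuousLinearEquiv.coe_ofBijective ..⟩)
  obtain ⟨ε, hε, h⟩ := Metric.mem_nhds_iff.1 hnhds
  refine ⟨ε, hε, fun b' hb' => ?_⟩
  obtain ⟨e, he⟩ := h (by rwa [Metric.mem_ball, dist_comm, dist_eq_norm] : b' ∈ _)
  obtain ⟨h₁, h₂, h₃⟩ := additionMap_bijective_iff.1 (by rw [← he]; exact e.bijective)
  refine ⟨h₁, h₂, ?_⟩
  rw [relDim_top_left, (Submodule.quotientEquivOfIsCompl _ _ h₃).length_eq]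

/-- The orthogonal complement of `N(a)` in `N(c ∘ a)`. -/
def orthoKer (a : X →L[ℂ] Y) (c : Y →L[ℂ] Z) : Submodule ℂ X :=
  (LinearMap.ker a.toLinearMap)ᗮ ⊓ LinearMap.ker (c ∘L a).toLinearMap

lemma isClosed_orthoKer (a : X →L[ℂ] Y) (c : Y →L[ℂ] Z) :
    IsClosed (orthoKer a c : Set X) :=
  (Submodule.isClosed_orthogonal _).inter (c ∘L a).isClosed_ker

lemma ker_inf_orthoKer (a : X →L[ℂ] Y) (c : Y →L[ℂ] Z) :
    LinearMap.ker a.toLinearMap ⊓ orthoKer a c = ⊥ := by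
  rw [orthoKer, ← inf_assoc, Submodule.inf_orthogonal_eq_bot, bot_inf_eq]

lemma ker_sup_orthoKer [CompleteSpace X] (a : X →L[ℂ] Y) (c : Y →L[ℂ] Z) :
    LinearMap.ker a.toLinearMap ⊔ orthoKer a c = LinearMap.ker (c ∘L a).toLinearMap := by
  have := a.isClosed_ker.completeSpace_coe
  refine Submodule.sup_orthogonal_inf_of_hasOrthogonalProjection fun x hx => ?_
  have : a x = 0 := hx
  simp [this]

lemma map_orthoKer [CompleteSpace X] (a : X →L[ℂ] Y) (c : Y →L[ℂ] Z) :
    (orthoKer a c).map a.toLinearMap =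
      LinearMap.ker c.toLinearMap ⊓ LinearMap.range a.toLinearMap := by
  have h := congrArg (Submodule.map a.toLinearMap) (ker_sup_orthoKer a c)
  have h₀ : (LinearMap.ker a.toLinearMap).map a.toLinearMap = ⊥ :=
    LinearMap.le_ker_iff_map.1 le_rfl
  rw [Submodule.map_sup, h₀, bot_sup_eq,
    ContinuousLinearMap.toLinearMap_comp, LinearMap.ker_comp, Submodule.map_comap_eq, inf_comm] at h
  exact h

lemma relDim_ker_comp {E E' E'' : Type*} [AddCommGroup E] [Module ℂ E] [AddCommGroup E']
    [Module ℂ E'] [AddCommGroup E''] [Module ℂ E''] (a : E →ₗ[ℂ] E') (c : E' →ₗ[ℂ] E'') :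
    relDim ⊤ (LinearMap.ker (c ∘ₗ a)) = relDim (LinearMap.range a) (LinearMap.ker c) := by
  rw [relDim_ker, relDim_ker, Submodule.map_top, LinearMap.range_comp]

variable {Z' : Type*} [NormedAddCommGroup Z'] [InnerProductSpace ℂ Z']

lemma exists_stable_orthoKer_decomposition [CompleteSpace X] [CompleteSpace Y] (b : X →L[ℂ] Y) (a : Y →L[ℂ] Z)
    (c : Z →L[ℂ] Z')
    (h₁ : relDim (LinearMap.ker a.toLinearMap) (LinearMap.range b.toLinearMap) ≠ ⊤)
    (h₂ : relDim (LinearMap.range a.toLinearMap) (LinearMap.ker c.toLinearMap) ≠ ⊤) :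
    relDim ⊤ ((orthoKer b a).map b.toLinearMap ⊔ orthoKer a c) ≠ ⊤ ∧
    ∃ ε > (0 : ℝ), ∀ b' : X →L[ℂ] Y, ‖b - b'‖ < ε →
      LinearMap.ker b'.toLinearMap ⊓ orthoKer b a = ⊥ ∧
      (orthoKer b a).map b'.toLinearMap ⊓ orthoKer a c = ⊥ ∧
      relDim ⊤ ((orthoKer b a).map b'.toLinearMap ⊔ orthoKer a c) =
        relDim ⊤ ((orthoKer b a).map b.toLinearMap ⊔ orthoKer a c) := by
  have hf : relDim ⊤ ((orthoKer b a).map b.toLinearMap ⊔ orthoKer a c) ≠ ⊤ := by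
    rw [map_orthoKer, relDim_trans (sup_le_sup_right inf_le_left _) le_top,
      relDim_sup_sup inf_le_left (ker_inf_orthoKer a c), relDim_inf_right, ker_sup_orthoKer]
    exact enat_add_ne_top.2 ⟨(relDim_ker_comp _ _).trans_ne h₂, h₁⟩
  refine ⟨hf, exists_stable_decomposition (isClosed_orthoKer _ _) (isClosed_orthoKer _ _)
    (ker_inf_orthoKer _ _) ?_ hf⟩
  rw [map_orthoKer, ← le_bot_iff, ← ker_inf_orthoKer a c]
  exact inf_le_inf_right _ inf_le_left

end Decomposition

section Chain

variable (H : ℤ → Type*) [∀ p, NormedAddCommGroup (H p)] [∀ p, InnerProductSpace ℂ (H p)]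
  (δ : ∀ p : ℤ, H p →L[ℂ] H (p - 1))

/-- The differential `δ p` with its target identified with `H q`, where `q = p - 1`. -/
def chainStep {p q : ℤ} (h : p - 1 = q) : H p →L[ℂ] H q := fcastL H h ∘L δ p

/-- The range of `chainStep`. -/
abbrev stepRange {p q : ℤ} (h : p - 1 = q) : Submodule ℂ (H q) :=
  LinearMap.range (chainStep H δ h).toLinearMap

/-- The orthogonal complement of `N(δ p)` in `N(δ (p-1) ∘ δ p)`. -/
def chainComplement (p : ℤ) : Submodule ℂ (H p) := orthoKer (δ p) (δ (p - 1))

lemma chainStep_rfl (p : ℤ) : chainStep H δ (rfl : p - 1 = p - 1) = δ p := rfl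

lemma chainRange_eq (p : ℤ) : chainRange H δ p = stepRange H δ (show p + 1 - 1 = p by ring) :=
  (LinearMap.range_comp _ _).symm

lemma isFredholmChain_iff : IsFredholmChain H δ ↔ ∀ (p q : ℤ) (h : p - 1 = q),
    relDim (LinearMap.ker (δ q).toLinearMap) (stepRange H δ h) ≠ ⊤ ∧
      relDim (stepRange H δ h) (LinearMap.ker (δ q).toLinearMap) ≠ ⊤ := by
  simp only [IsFredholmChain, finite_relQuot_iff, chainRange_eq]
  refine ⟨fun hf p q h => ?_, fun hf q => hf (q + 1) q _⟩
  obtain rfl : p = q + 1 := by lia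
  exact hf q

lemma relDim_stepRange_ker_ne_top
    (hδ : ∀ p : ℤ, FiniteDimensional ℂ (LinearMap.range (chainComp H δ p).toLinearMap))
    {p q : ℤ} (h : p - 1 = q) :
    relDim (stepRange H δ h) (LinearMap.ker (δ q).toLinearMap) ≠ ⊤ := by
  obtain rfl : p = q + 1 := by lia
  rw [relDim_ker, ← LinearMap.range_comp]
  exact length_ne_top_of_finite (hδ q)

lemma relDim_stepRange_map {p q : ℤ} (h : p - 1 = q) (U : Submodule ℂ (H p)) :
    relDim (stepRange H δ h) (U.map (chainStep H δ h).toLinearMap) =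
      relDim (LinearMap.range (δ p).toLinearMap) (U.map (δ p).toLinearMap) := by
  subst h
  rfl

/-- The subspaces `U p ≤ H p` are complements of the kernels of `δ` up to finite dimension, in
such a way that `H q` is, up to finite dimension, the direct sum of `δ (U p)` and `U q` for
`q = p - 1`; the dimension defect is `f q`. -/
def IsSplitBy (U : ∀ p, Submodule ℂ (H p)) (f : ℤ → ℕ∞) : Prop :=
  ∀ (p q : ℤ) (h : p - 1 = q),
    LinearMap.ker (chainStep H δ h).toLinearMap ⊓ U p = ⊥ ∧
    (U p).map (chainStep H δ h).toLinearMap ⊓ U q = ⊥ ∧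
    relDim ⊤ ((U p).map (chainStep H δ h).toLinearMap ⊔ U q) = f q

variable {H δ}

lemma IsFredholmChain.exists_isSplitBy [∀ p, CompleteSpace (H p)] (n : ℕ)
    (hzero : ∀ p : ℤ, (p < 0 ∨ (n : ℤ) + 1 ≤ p) → Subsingleton (H p))
    (hfred : IsFredholmChain H δ) :
    ∃ (f : ℤ → ℕ∞), (∀ p, f p ≠ ⊤) ∧ ∃ ε > (0 : ℝ), ∀ δ' : ∀ p : ℤ, H p →L[ℂ] H (p - 1),
      (∀ p : ℤ, ‖δ p - δ' p‖ < ε) → IsSplitBy H δ' (chainComplement H δ) f := by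
  rw [isFredholmChain_iff] at hfred
  have key (p : ℤ) := exists_stable_orthoKer_decomposition (δ p) (δ (p - 1)) (δ (p - 1 - 1))
    (hfred p _ rfl).1 (hfred (p - 1) _ rfl).2
  choose hf ε hε hst using key
  let f (q : ℤ) : ℕ∞ := relDim ⊤ ((chainComplement H δ (q + 1)).map
    (chainStep H δ (show q + 1 - 1 = q by ring)).toLinearMap ⊔ chainComplement H δ q)
  have hfp (p : ℤ) : f (p - 1) = relDim ⊤ ((orthoKer (δ p) (δ (p - 1))).map (δ p).toLinearMap ⊔
      orthoKer (δ (p - 1)) (δ (p - 1 - 1))) := by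
    have gen (p p' : ℤ) (e : p = p') (h : p - 1 = p' - 1) :
        relDim ⊤ ((chainComplement H δ p).map (chainStep H δ h).toLinearMap ⊔
          chainComplement H δ (p' - 1)) =
        relDim ⊤ ((orthoKer (δ p') (δ (p' - 1))).map (δ p').toLinearMap ⊔
          orthoKer (δ (p' - 1)) (δ (p' - 1 - 1))) := by
      subst e
      rfl
    exact gen _ _ (by ring) _
  refine ⟨f, fun q => ?_, (Finset.range (n + 1)).inf' (by simp) (fun i : ℕ => ε i),
    (Finset.lt_inf'_iff _).2 fun i _ => hε i, fun δ' hδ' p q h => ?_⟩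
  · exact (congrArg f (add_sub_cancel_right q 1).symm).trans_ne ((hfp (q + 1)).trans_ne (hf (q + 1)))
  · subst h
    rw [hfp, chainStep_rfl]
    refine hst p (δ' p) ?_
    by_cases hp : p < 0 ∨ (n : ℤ) + 1 ≤ p
    · have := hzero p hp
      rw [Subsingleton.elim (δ p - δ' p) 0, norm_zero]
      exact hε p
    · rw [not_or, not_lt, not_le] at hp
      lift p to ℕ using hp.1
      exact (hδ' p).trans_le (Finset.inf'_le _ (Finset.mem_range.2 (by exact_mod_cast hp.2)))

lemma IsSplitBy.index {U : ∀ p, Submodule ℂ (H p)} {f : ℤ → ℕ∞} (hU : IsSplitBy H δ U f)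
    (hf : ∀ p, f p ≠ ⊤)
    (hδ : ∀ p : ℤ, FiniteDimensional ℂ (LinearMap.range (chainComp H δ p).toLinearMap)) :
    IsFredholmChain H δ ∧ ∀ p,
      (finrank ℂ (relQuot (LinearMap.ker (δ p).toLinearMap) (chainRange H δ p)) : ℤ)
        - (finrank ℂ (relQuot (chainRange H δ p) (LinearMap.ker (δ p).toLinearMap)) : ℤ) =
      (f p).toNat
        - (relDim (LinearMap.range (δ p).toLinearMap) ((U p).map (δ p).toLinearMap)).toNat
        - (relDim (LinearMap.range (δ (p + 1)).toLinearMap)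
            ((U (p + 1)).map (δ (p + 1)).toLinearMap)).toNat := by
  have hr (p : ℤ) :
      relDim (LinearMap.range (δ p).toLinearMap) ((U p).map (δ p).toLinearMap) ≠ ⊤ := by
    obtain ⟨-, h₂, h₃⟩ := hU (p + 1) p (by ring)
    refine relDim_range_map_ne_top _ h₂ (hU p _ rfl).1 (h₃.trans_ne (hf p)) ?_
    exact ne_top_of_le_ne_top (relDim_stepRange_ker_ne_top H δ hδ _)
      (relDim_mono_left LinearMap.map_le_range _)
  have key (p q : ℤ) (h : p - 1 = q) := relDim_ker_sub_relDim (δ q).toLinearMap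
    (R := stepRange H δ h) LinearMap.map_le_range (hU p q h).2.1 (hU q _ rfl).1
    ((hU p q h).2.2.trans_ne (hf q)) (relDim_stepRange_ker_ne_top H δ hδ h)
    ((relDim_stepRange_map H δ h (U p)).trans_ne (hr p))
  have hfred : IsFredholmChain H δ := (isFredholmChain_iff H δ).2 fun p q h =>
    ⟨(key p q h).1, relDim_stepRange_ker_ne_top H δ hδ h⟩
  refine ⟨hfred, fun p => ?_⟩
  have hp := (key (p + 1) p (by ring)).2
  rw [(hU (p + 1) p _).2.2, relDim_stepRange_map, ← chainRange_eq,
    ← coe_finrank_relQuot (finite_relQuot_iff.1 (hfred p).1),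
    ← coe_finrank_relQuot (finite_relQuot_iff.1 (hfred p).2),
    ENat.toNat_natCast, ENat.toNat_natCast] at hp
  exact hp

lemma sum_neg_one_pow_mul_add (x : ℕ → ℤ) (m : ℕ) :
    ∑ j ∈ Finset.range m, (-1 : ℤ) ^ j * (x j + x (j + 1)) = x 0 - (-1) ^ m * x m := by
  induction m with
  | zero => simp
  | succ m ih => rw [Finset.sum_range_succ, ih, pow_succ]; ring

lemma IsSplitBy.chainIndex_eq {U : ∀ p, Submodule ℂ (H p)} {f : ℤ → ℕ∞}
    (hU : IsSplitBy H δ U f) (hf : ∀ p, f p ≠ ⊤)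
    (hδ : ∀ p : ℤ, FiniteDimensional ℂ (LinearMap.range (chainComp H δ p).toLinearMap))
    (n : ℕ) (hzero : ∀ p : ℤ, (p < 0 ∨ (n : ℤ) + 1 ≤ p) → Subsingleton (H p)) :
    chainIndex H δ n = ∑ j ∈ Finset.range (n + 1), (-1 : ℤ) ^ j * ((f j).toNat : ℤ) := by
  obtain ⟨r, hr⟩ : ∃ r : ℤ → ℤ, ∀ p, r p = (relDim (LinearMap.range (δ p).toLinearMap)
    ((U p).map (δ p).toLinearMap)).toNat := ⟨_, fun _ => rfl⟩
  have hr_zero (p : ℤ) (hp : δ p = 0) : r p = 0 := by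
    have h : LinearMap.range (δ p).toLinearMap = ⊥ := by
      rw [hp]
      exact LinearMap.range_zero
    rw [hr, h, relDim_bot_left]
    rfl
  have hr₀ : r (0 : ℕ) = 0 := by
    have : Subsingleton (H (((0 : ℕ) : ℤ) - 1)) := hzero _ (by simp)
    exact hr_zero _ (Subsingleton.elim _ _)
  have hr₁ : r (n + 1 : ℕ) = 0 := by
    have : Subsingleton (H ((n + 1 : ℕ) : ℤ)) := hzero _ (by simp)
    exact hr_zero _ (Subsingleton.elim _ _)
  have hsum := sum_neg_one_pow_mul_add (fun j => r j) (n + 1)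
  simp only [hr₀, hr₁, mul_zero, sub_zero] at hsum
  rw [← sub_eq_zero, ← neg_eq_zero, ← hsum, chainIndex, ← Finset.sum_sub_distrib,
    ← Finset.sum_neg_distrib]
  refine Finset.sum_congr rfl fun j _ => ?_
  rw [(hU.index hf hδ).2 j, ← hr, ← hr, Nat.cast_add, Nat.cast_one]
  ring

end Chain

theorem fredholm_chain_stability (H : ℤ → Type) [∀ p, NormedAddCommGroup (H p)]
    [∀ p, InnerProductSpace ℂ (H p)] [∀ p, CompleteSpace (H p)] (n : ℕ)
    (hzero : ∀ p : ℤ, (p < 0 ∨ (n : ℤ) + 1 ≤ p) → Subsingleton (H p))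
    (δ : ∀ p : ℤ, H p →L[ℂ] H (p - 1))
    (hfred : IsFredholmChain H δ) :
    ∃ ε > (0 : ℝ), ∀ δ' : ∀ p : ℤ, H p →L[ℂ] H (p - 1),
      (∀ p : ℤ, FiniteDimensional ℂ (LinearMap.range (chainComp H δ' p).toLinearMap)) →
      (∀ p : ℤ, ‖δ p - δ' p‖ < ε) →
      IsFredholmChain H δ' ∧ chainIndex H δ n = chainIndex H δ' n := by
  obtain ⟨f, hf, ε, hε, hsplit⟩ := hfred.exists_isSplitBy n hzero
  refine ⟨ε, hε, fun δ' hδ' hnear => ?_⟩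
  have hδ (p : ℤ) : FiniteDimensional ℂ (LinearMap.range (chainComp H δ p).toLinearMap) := by
    have h := (finite_relQuot_iff.1 (hfred p).2)
    rw [chainRange_eq, relDim_ker, ← LinearMap.range_comp] at h
    exact finite_of_length_ne_top h
  refine ⟨((hsplit δ' hnear).index hf hδ').1, ?_⟩
  rw [(hsplit δ' hnear).chainIndex_eq hf hδ' n hzero,
    (hsplit δ fun p => by simpa using hε).chainIndex_eq hf hδ n hzero]
end
end
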